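/- Let n ≥ 2 and δ > 0. Suppose φ ∈ C²(D) satisfies either (i) □φ + |φ|^{p−1}φ = 0 on D with 1 ≤ p < 1 + 4/(n−1), or (ii) □φ − |φ|^{p−1}φ = 0 on D with p ≥ 1 + 4/(n−1), and suppose φ satisfies the decay condition Dec(δ). Then φ = 0 everywhere on D. -/

import Mathlib

open Real MeasureTheory
open scoped BigOperators

noncomputable section

/-- Minkowski spacetime `ℝ^{1+n}`, with coordinates `(t, x)`. -/
abbrev Spacetime (n : ℕ) := ℝ × EuclideanSpace ℝ (Fin n)

/-- The exterior `D` of the light cone: `{(t,x) : |t| < |x|}`. -/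
def Dom (n : ℕ) : Set (Spacetime n) := {p | |p.1| < ‖p.2‖}

/-- Partial derivative in the time direction. -/
def dt {n : ℕ} (φ : Spacetime n → ℝ) (p : Spacetime n) : ℝ :=
  fderiv ℝ φ p (1, 0)

/-- Partial derivative in the `i`-th spatial direction. -/
def dx {n : ℕ} (i : Fin n) (φ : Spacetime n → ℝ) (p : Spacetime n) : ℝ :=
  fderiv ℝ φ p (0, EuclideanSpace.single i 1)

/-- The wave operator `□φ = −∂²_t φ + Δ_x φ`. -/
def box {n : ℕ} (φ : Spacetime n → ℝ) (p : Spacetime n) : ℝ :=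
  - dt (dt φ) p + ∑ i, dx i (dx i φ) p

/-- Null coordinate `u = (t − r)/2`. -/
def uu {n : ℕ} (p : Spacetime n) : ℝ := (p.1 - ‖p.2‖) / 2

/-- Null coordinate `v = (t + r)/2`. -/
def vv {n : ℕ} (p : Spacetime n) : ℝ := (p.1 + ‖p.2‖) / 2

/-- Radial derivative `∂_r φ = (x/|x|)·∇_x φ`. -/
def dr {n : ℕ} (φ : Spacetime n → ℝ) (p : Spacetime n) : ℝ :=
  (∑ i, p.2 i * dx i φ p) / ‖p.2‖

/-- `∂_u φ := ∂_t φ − ∂_r φ`. -/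
def du {n : ℕ} (φ : Spacetime n → ℝ) (p : Spacetime n) : ℝ := dt φ p - dr φ p

/-- `∂_v φ := ∂_t φ + ∂_r φ`. -/
def dv {n : ℕ} (φ : Spacetime n → ℝ) (p : Spacetime n) : ℝ := dt φ p + dr φ p

/-- The squared angular gradient `|∇̸φ|² = |∇_x φ|² − (∂_r φ)²`. -/
def angSq {n : ℕ} (φ : Spacetime n → ℝ) (p : Spacetime n) : ℝ :=
  (∑ i, (dx i φ p) ^ 2) - (dr φ p) ^ 2

/-- The decay condition `Dec(γ)` on `D`. -/
def Dec {n : ℕ} (γ : ℝ) (φ : Spacetime n → ℝ) : Prop :=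
  (∃ C : ℝ, ∀ p ∈ Dom n,
    ((1 + |uu p|) * (1 + |vv p|)) ^ (((n : ℝ) - 1 + γ) / 2) *
      (|uu p * du φ p| + |vv p * dv φ p|) ≤ C) ∧
  (∃ C : ℝ, ∀ p ∈ Dom n, |uu p * vv p| < 1 →
    ((1 + |uu p|) * (1 + |vv p|)) ^ (((n : ℝ) - 1 + γ) / 2) *
      |uu p * vv p| ^ ((1 : ℝ) / 2) * Real.sqrt (angSq φ p) ≤ C) ∧
  (∃ C : ℝ, ∀ p ∈ Dom n,
    ((1 + |uu p|) * (1 + |vv p|)) ^ (((n : ℝ) - 1 + γ) / 2) * |φ p| ≤ C)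


lemma clm_expand {n : ℕ} (L : Spacetime n →L[ℝ] ℝ) (v : Spacetime n) :
    L v = v.1 * L (1, 0) + ∑ i, v.2 i * L (0, EuclideanSpace.single i 1) := by
  have h : v = v.1 • ((1 : ℝ), (0 : EuclideanSpace ℝ (Fin n)))
      + ∑ i, v.2 i • ((0 : ℝ), (EuclideanSpace.single i (1:ℝ) : EuclideanSpace ℝ (Fin n))) := by
    ext i
    · simp [Prod.fst_sum]
    · simp [Prod.snd_sum, Finset.sum_apply, Pi.single_apply]
  conv_lhs => rw [h]
  simp only [map_add, map_sum, map_smul, smul_eq_mul]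

/-- raised gradient -/
def Yv {n : ℕ} (χ : Spacetime n → ℝ) (q : Spacetime n) : Spacetime n :=
  (- dt χ q, WithLp.toLp 2 (fun i => dx i χ q))

def NN {n : ℕ} (q : Spacetime n) : ℝ := ‖q.2‖ ^ 2 - q.1 ^ 2

def J0 {n : ℕ} (χ A B : Spacetime n → ℝ) (q : Spacetime n) : ℝ := - dt χ q * A q + q.1 * B q
def Ji {n : ℕ} (χ A B : Spacetime n → ℝ) (i : Fin n) (q : Spacetime n) : ℝ :=
  dx i χ q * A q + q.2 i * B q

lemma dt_diff {n : ℕ} {χ : Spacetime n → ℝ} {q : Spacetime n} (h : ContDiffAt ℝ 2 χ q) (v : Spacetime n) :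
    ContDiffAt ℝ 1 (fun q => fderiv ℝ χ q v) q := by
  have := h.fderiv_right (m := 1) (by norm_num)
  exact this.clm_apply contDiffAt_const

lemma div_J {n : ℕ} {χ A B : Spacetime n → ℝ} {q : Spacetime n} (h : ContDiffAt ℝ 2 χ q)
    (hA : DifferentiableAt ℝ A q) (hB : DifferentiableAt ℝ B q) :
    dt (J0 χ A B) q + ∑ i, dx i (Ji χ A B i) q =
      A q * box χ q + fderiv ℝ A q (Yv χ q) + (n + 1) * B q + fderiv ℝ B q q := by
  have e0 : dt (J0 χ A B) q = - dt (dt χ) q * A q - dt χ q * dt A q + B q + q.1 * dt B q := by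
    have h1 : DifferentiableAt ℝ (dt χ) q := (dt_diff h _).differentiableAt (by norm_num)
    have H : HasFDerivAt (J0 χ A B) _ q :=
      ((h1.hasFDerivAt.neg.mul hA.hasFDerivAt).add (hasFDerivAt_fst.mul hB.hasFDerivAt))
    unfold dt at H ⊢
    rw [H.fderiv]
    simp
    ring
  have ei : ∀ i, dx i (Ji χ A B i) q = dx i (dx i χ) q * A q + dx i χ q * dx i A q + B q
      + q.2 i * dx i B q := by
    intro i
    have h1 : DifferentiableAt ℝ (dx i χ) q := (dt_diff h _).differentiableAt (by norm_num)
    have h2 : HasFDerivAt (fun q : Spacetime n => q.2 i)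
      ((EuclideanSpace.proj i).comp (ContinuousLinearMap.snd ℝ ℝ (EuclideanSpace ℝ (Fin n)))) q :=
      ((EuclideanSpace.proj i).comp (ContinuousLinearMap.snd ℝ ℝ (EuclideanSpace ℝ (Fin n)))).hasFDerivAt
    have H : HasFDerivAt (Ji χ A B i) _ q :=
      ((h1.hasFDerivAt.mul hA.hasFDerivAt).add (h2.mul hB.hasFDerivAt))
    unfold dx at H ⊢
    rw [H.fderiv]
    simp
    ring
  rw [e0, Finset.sum_congr rfl (fun i _ => ei i)]
  simp only [Finset.sum_add_distrib, ← Finset.sum_mul]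
  rw [clm_expand (fderiv ℝ A q), clm_expand (fderiv ℝ B q) q]
  simp [Yv, box, dt, dx]
  ring

lemma hasFDerivAt_NN {n : ℕ} (q : Spacetime n) :
    HasFDerivAt (NN (n := n)) ((2:ℝ) • ((innerSL ℝ q.2).comp (ContinuousLinearMap.snd ℝ ℝ _)
      - q.1 • ContinuousLinearMap.fst ℝ ℝ _)) q := by
  have h1 : HasFDerivAt (fun q : Spacetime n => ‖q.2‖ ^ 2) _ q := (hasFDerivAt_snd (𝕜 := ℝ) (p := q)).norm_sq
  have h2 : HasFDerivAt (fun q : Spacetime n => q.1 ^ 2) _ q := (hasFDerivAt_fst (𝕜 := ℝ) (p := q)).pow 2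
  refine (h1.sub h2).congr_fderiv ?_
  ext v <;> simp

lemma fderiv_NN {n : ℕ} (q v : Spacetime n) :
    fderiv ℝ (NN (n := n)) q v = 2 * (inner ℝ q.2 v.2 - q.1 * v.1) := by
  rw [(hasFDerivAt_NN q).fderiv]; simp

lemma inner_eq_sum' {n : ℕ} (x y : EuclideanSpace ℝ (Fin n)) : inner ℝ x y = ∑ i, x i * y i := by
  simp [PiLp.inner_apply, mul_comm]

lemma fderiv_NN_self {n : ℕ} (q : Spacetime n) : fderiv ℝ (NN (n := n)) q q = 2 * NN q := by
  rw [fderiv_NN]; simp [NN]; ring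

lemma fderiv_NN_Y {n : ℕ} (χ : Spacetime n → ℝ) (q : Spacetime n) :
    fderiv ℝ (NN (n := n)) q (Yv χ q) = 2 * fderiv ℝ χ q q := by
  rw [fderiv_NN, clm_expand (fderiv ℝ χ q) q, inner_eq_sum']
  simp [Yv, dt, dx]; ring

lemma contDiff_NN {n : ℕ} : ContDiff ℝ 2 (NN (n := n)) := by
  unfold NN
  exact (contDiff_snd.norm_sq ℝ).sub (contDiff_fst.pow 2)

lemma NN_pos {n : ℕ} {q : Spacetime n} (h : q ∈ Dom n) : 0 < NN q := by
  unfold NN Dom at *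
  have : |q.1| < ‖q.2‖ := h
  have := sq_lt_sq' (by linarith [abs_nonneg q.1, norm_nonneg q.2]) this
  rw [sq_abs] at this; linarith

lemma isOpen_Dom {n : ℕ} : IsOpen (Dom n) :=
  isOpen_lt (by fun_prop) (by fun_prop)

/-- P = <∂χ,∂χ> -/
def PP {n : ℕ} (χ : Spacetime n → ℝ) (q : Spacetime n) : ℝ := - (dt χ q)^2 + ∑ i, (dx i χ q)^2

lemma fderiv_Y {n : ℕ} (χ : Spacetime n → ℝ) (q : Spacetime n) :
    fderiv ℝ χ q (Yv χ q) = PP χ q := by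
  rw [clm_expand]; simp [Yv, PP, dt, dx, sq]

def SS {n : ℕ} (χ : Spacetime n → ℝ) (q : Spacetime n) : ℝ := fderiv ℝ χ q q

lemma hasFDerivAt_SS {n : ℕ} {χ : Spacetime n → ℝ} {q : Spacetime n} (h : ContDiffAt ℝ 2 χ q) :
    ∃ L : Spacetime n →L[ℝ] ℝ, HasFDerivAt (SS χ) L q ∧ ∀ v, L v = fderiv ℝ χ q v + fderiv ℝ (fderiv ℝ χ) q v q := by
  have h1 := (h.fderiv_right (m := 1) (by norm_num)).differentiableAt (by norm_num)
  refine ⟨_, h1.hasFDerivAt.clm_apply (hasFDerivAt_id q), fun v => ?_⟩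
  simp

lemma hasFDerivAt_PP {n : ℕ} {χ : Spacetime n → ℝ} {q : Spacetime n} (h : ContDiffAt ℝ 2 χ q) :
    ∃ L : Spacetime n →L[ℝ] ℝ, HasFDerivAt (PP χ) L q ∧ L q = 2 * fderiv ℝ (fderiv ℝ χ) q (Yv χ q) q := by
  have h1 := (h.fderiv_right (m := 1) (by norm_num)).differentiableAt (by norm_num)
  have h2 : ∀ v : Spacetime n, HasFDerivAt (fun q => fderiv ℝ χ q v) _ q :=
    fun v => h1.hasFDerivAt.clm_apply (hasFDerivAt_const v q)
  have h0 : HasFDerivAt (fun q => - (dt χ q)^2) _ q := ((h2 (1,0)).pow 2).neg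
  have hi : HasFDerivAt (fun q => ∑ i, (dx i χ q)^2) _ q := HasFDerivAt.fun_sum (u := Finset.univ) (fun i _ => (h2 (0,EuclideanSpace.single i 1)).pow 2)
  refine ⟨_, h0.add hi, ?_⟩
  have hs : IsSymmSndFDerivAt ℝ χ q := h.isSymmSndFDerivAt (by simp)
  rw [hs.eq, clm_expand (fderiv ℝ (fderiv ℝ χ) q q)]
  simp [Yv, dt, dx, mul_add, Finset.mul_sum]
  simp only [mul_assoc]

lemma hasFDerivAt_NNpow {n : ℕ} {q : Spacetime n} (h : 0 < NN q) (a : ℝ) :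
    ∃ L : Spacetime n →L[ℝ] ℝ, HasFDerivAt (fun q => NN q ^ a) L q ∧
      ∀ v, L v = a * NN q ^ a / NN q * fderiv ℝ (NN (n := n)) q v := by
  refine ⟨_, ((hasFDerivAt_NN q).rpow_const (p := a) (Or.inl h.ne')), fun v => ?_⟩
  rw [(hasFDerivAt_NN q).fderiv, Real.rpow_sub_one h.ne']
  simp only [_root_.smul_apply, smul_eq_mul]
  ring

def Wt {n : ℕ} (q : Spacetime n) : ℝ := NN q ^ (-((n : ℝ) + 1) / 2)

def curA {n : ℕ} (χ η ηs : Spacetime n → ℝ) (q : Spacetime n) : ℝ :=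
  Wt q * (NN q * (η q * SS χ q + 1 / 2 * (ηs q * χ q)))

def curB {n : ℕ} (a b : ℝ) (χ η M : Spacetime n → ℝ) (q : Spacetime n) : ℝ :=
  Wt q * (η q * (a / 2 * (χ q * χ q) + b * M q - 1 / 2 * (NN q * PP χ q)))

lemma key_identity {n : ℕ} {χ η ηs M : Spacetime n → ℝ} {q : Spacetime n} {ε σ p k F : ℝ}
    (hN : 0 < NN q) (h : ContDiffAt ℝ 2 χ q)
    (hη : DifferentiableAt ℝ η q) (hηs : DifferentiableAt ℝ ηs q) (hM : DifferentiableAt ℝ M q)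
    (hp : 1 ≤ p)
    (e1 : fderiv ℝ η q q = ηs q)
    (e2 : fderiv ℝ M q q = k * M q + (p + 1) * F * SS χ q)
    (e3 : χ q * F = M q)
    (e4 : NN q * box χ q = (n - 1 + 2 * ε) * SS χ q + (((n - 1) / 2) ^ 2 - ε ^ 2) * χ q - σ * F) :
    curA χ η ηs q * box χ q + fderiv ℝ (curA χ η ηs) q (Yv χ q)
      + (n + 1) * curB (ε ^ 2 - ((n - 1) / 2) ^ 2) (σ / (p + 1)) χ η M q
      + fderiv ℝ (curB (ε ^ 2 - ((n - 1) / 2) ^ 2) (σ / (p + 1)) χ η M) q q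
    = Wt q * (η q * (2 * ε * SS χ q ^ 2 + σ * k / (p + 1) * M q)
        + NN q * fderiv ℝ η q (Yv χ q) * SS χ q + ηs q * (ε * χ q * SS χ q)
        + ηs q * (σ * (1 / (p + 1) - 1 / 2) * M q)
        + 1 / 2 * (NN q * fderiv ℝ ηs q (Yv χ q)) * χ q) := by
  obtain ⟨LW, hLW, hLW'⟩ := hasFDerivAt_NNpow hN (-((n : ℝ) + 1) / 2)
  obtain ⟨LS, hLS, hLS'⟩ := hasFDerivAt_SS h
  obtain ⟨LP, hLP, hLP'⟩ := hasFDerivAt_PP h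
  have hχ := (h.differentiableAt (by norm_num)).hasFDerivAt
  have hN' := (hasFDerivAt_NN q).differentiableAt.hasFDerivAt
  have HA : HasFDerivAt (curA χ η ηs) _ q :=
    hLW.mul (hN'.mul ((hη.hasFDerivAt.mul hLS).add ((hηs.hasFDerivAt.mul hχ).const_mul (1/2))))
  have HB : HasFDerivAt (curB (ε ^ 2 - ((n - 1) / 2) ^ 2) (σ / (p + 1)) χ η M) _ q :=
    hLW.mul (hη.hasFDerivAt.mul ((((hχ.mul hχ).const_mul ((ε ^ 2 - ((n - 1) / 2) ^ 2)/2)).add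
      (hM.hasFDerivAt.const_mul (σ / (p + 1)))).sub ((hN'.mul hLP).const_mul (1/2))))
  rw [HA.fderiv, HB.fderiv]
  have eS : fderiv ℝ χ q q = SS χ q := rfl
  have hW : NN q ^ (-((n : ℝ) + 1) / 2) = Wt q := rfl
  simp only [hW, _root_.add_apply, _root_.sub_apply,
    _root_.smul_apply, smul_eq_mul,
    hLW', hLS', hLP', fderiv_NN_self, fderiv_NN_Y, fderiv_Y, e1, e2, eS, curA, curB]
  have hb : box χ q = ((n - 1 + 2 * ε) * SS χ q + (((n - 1) / 2) ^ 2 - ε ^ 2) * χ q - σ * F) / NN q := by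
    rw [← e4]; field_simp
  have hp' : p + 1 ≠ 0 := by linarith
  rw [hb, ← e3]
  field_simp
  ring

/-- the conjugated function -/
def chi {n : ℕ} (b : ℝ) (φ : Spacetime n → ℝ) (q : Spacetime n) : ℝ := NN q ^ b * φ q

lemma fderiv_chi {n : ℕ} {b : ℝ} {φ : Spacetime n → ℝ} {q : Spacetime n} (hN : 0 < NN q)
    (h : DifferentiableAt ℝ φ q) (v : Spacetime n) :
    fderiv ℝ (chi b φ) q v = NN q ^ b * fderiv ℝ φ q v
      + b * NN q ^ b / NN q * fderiv ℝ (NN (n := n)) q v * φ q := by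
  obtain ⟨L, hL, hL'⟩ := hasFDerivAt_NNpow hN b
  have H : HasFDerivAt (chi b φ) _ q := hL.mul h.hasFDerivAt
  rw [H.fderiv]
  simp only [_root_.add_apply, _root_.smul_apply, smul_eq_mul, hL']
  ring

lemma fderiv2_chi {n : ℕ} {b : ℝ} {φ : Spacetime n → ℝ} {q : Spacetime n} (hq : q ∈ Dom n)
    (hφ : ContDiffOn ℝ 2 φ (Dom n)) (e : Spacetime n) :
    fderiv ℝ (fun q => fderiv ℝ (chi b φ) q e) q e =
      NN q ^ b * fderiv ℝ (fun q => fderiv ℝ φ q e) q e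
      + 2 * b * NN q ^ b / NN q * fderiv ℝ (NN (n := n)) q e * fderiv ℝ φ q e
      + φ q * (b * NN q ^ b / NN q * (2 * (inner ℝ e.2 e.2 - e.1 * e.1))
         + b * (b - 1) * NN q ^ b / NN q ^ 2 * (fderiv ℝ (NN (n := n)) q e) ^ 2) := by
  have hN := NN_pos hq
  have hc : ContDiffAt ℝ 2 φ q := hφ.contDiffAt (isOpen_Dom.mem_nhds hq)
  have hev : (fun q => fderiv ℝ (chi b φ) q e) =ᶠ[nhds q] (fun q => NN q ^ b * fderiv ℝ φ q e
      + b * (NN q ^ (b - 1) * (fderiv ℝ (NN (n := n)) q e * φ q))) := by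
    filter_upwards [isOpen_Dom.mem_nhds hq] with q' hq'
    rw [fderiv_chi (NN_pos hq') ((hφ.contDiffAt (isOpen_Dom.mem_nhds hq')).differentiableAt (by norm_num)),
      Real.rpow_sub_one (NN_pos hq').ne']
    ring
  rw [hev.fderiv_eq]
  obtain ⟨L, hL, hL'⟩ := hasFDerivAt_NNpow hN b
  obtain ⟨L1, hL1, hL1'⟩ := hasFDerivAt_NNpow hN (b - 1)
  have h2 := ((dt_diff hc e).differentiableAt (by norm_num)).hasFDerivAt
  have h3 : ∃ l : Spacetime n →L[ℝ] ℝ, HasFDerivAt (fun q => fderiv ℝ (NN (n := n)) q e) l q ∧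
      l e = 2 * (inner ℝ e.2 e.2 - e.1 * e.1) := by
    refine ⟨(2:ℝ) • ((innerSL ℝ e.2).comp (ContinuousLinearMap.snd ℝ ℝ _)
      - e.1 • ContinuousLinearMap.fst ℝ ℝ _), ?_, ?_⟩
    · have : (fun q => fderiv ℝ (NN (n := n)) q e) = ((2:ℝ) • ((innerSL ℝ e.2).comp (ContinuousLinearMap.snd ℝ ℝ _)
        - e.1 • ContinuousLinearMap.fst ℝ ℝ _) : Spacetime n →L[ℝ] ℝ) := by
        ext q; rw [fderiv_NN]; simp [real_inner_comm, mul_comm]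
      rw [this]
      exact ContinuousLinearMap.hasFDerivAt _
    · simp
  obtain ⟨l, hl, hl'⟩ := h3
  have hφ1 := (hc.differentiableAt (by norm_num)).hasFDerivAt
  have H : HasFDerivAt (fun q => NN q ^ b * fderiv ℝ φ q e
      + b * (NN q ^ (b - 1) * (fderiv ℝ (NN (n := n)) q e * φ q))) _ q := (hL.mul h2).add ((hL1.mul (hl.mul hφ1)).const_mul b)
  rw [H.fderiv]
  simp only [_root_.add_apply, _root_.smul_apply, smul_eq_mul, hL', hL1', hl', Pi.mul_apply]
  rw [Real.rpow_sub_one hN.ne']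
  field_simp
  ring

lemma box_chi {n : ℕ} {b : ℝ} {φ : Spacetime n → ℝ} {q : Spacetime n} (hq : q ∈ Dom n)
    (hφ : ContDiffOn ℝ 2 φ (Dom n)) :
    box (chi b φ) q = NN q ^ b * box φ q + 4 * b * NN q ^ b / NN q * SS φ q
      + φ q * (2 * b * (n + 1) * NN q ^ b / NN q + 4 * b * (b - 1) * NN q ^ b / NN q) := by
  have hN := NN_pos hq
  have h0 : dt (dt (chi b φ)) q = _ := fderiv2_chi (b := b) hq hφ (1,0)
  have hi : ∀ i, dx i (dx i (chi b φ)) q = _ := fun i => fderiv2_chi (b := b) hq hφ (0, EuclideanSpace.single i 1)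
  unfold box
  rw [h0, Finset.sum_congr rfl (fun i _ => hi i)]
  simp only [fderiv_NN, SS]
  rw [clm_expand (fderiv ℝ φ q) q]
  simp [EuclideanSpace.inner_single_right, Finset.sum_add_distrib, mul_add, ← Finset.mul_sum]
  have hNs : ∑ i, q.2 i ^ 2 = NN q + q.1 ^ 2 := by
    simp [NN, EuclideanSpace.norm_sq_eq]
  have e1 : ∑ i, 2 * b * NN q ^ b / NN q * (2 * q.2 i) * fderiv ℝ φ q (0, EuclideanSpace.single i 1)
    = 4 * b * NN q ^ b / NN q * ∑ i, q.2 i * fderiv ℝ φ q (0, EuclideanSpace.single i 1) := by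
    rw [Finset.mul_sum]; refine Finset.sum_congr rfl (fun i _ => by ring)
  have e2 : ∑ i, (2 * q.2 i) ^ 2 = 4 * (NN q + q.1 ^ 2) := by
    rw [← hNs, Finset.mul_sum]; refine Finset.sum_congr rfl (fun i _ => by ring)
  rw [e1, e2]
  unfold dt dx
  field_simp
  ring

lemma SS_chi {n : ℕ} {b : ℝ} {φ : Spacetime n → ℝ} {q : Spacetime n} (hN : 0 < NN q)
    (h : DifferentiableAt ℝ φ q) :
    SS (chi b φ) q = NN q ^ b * (SS φ q + 2 * b * φ q) := by
  unfold SS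
  rw [fderiv_chi hN h, fderiv_NN_self]
  field_simp

lemma pde_chi {n : ℕ} {φ : Spacetime n → ℝ} {q : Spacetime n} {ε σ p : ℝ} (hq : q ∈ Dom n)
    (hφ : ContDiffOn ℝ 2 φ (Dom n)) (heq : box φ q = - σ * (|φ q| ^ (p - 1) * φ q)) :
    NN q * box (chi (((n - 1) / 2 + ε) / 2) φ) q = (n - 1 + 2 * ε) * SS (chi (((n - 1) / 2 + ε) / 2) φ) q
      + (((n - 1) / 2) ^ 2 - ε ^ 2) * chi (((n - 1) / 2 + ε) / 2) φ q
      - σ * (NN q * NN q ^ (((n - 1) / 2 + ε) / 2) * (|φ q| ^ (p - 1) * φ q)) := by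
  have hN := NN_pos hq
  have hc : ContDiffAt ℝ 2 φ q := hφ.contDiffAt (isOpen_Dom.mem_nhds hq)
  rw [box_chi hq hφ, SS_chi hN (hc.differentiableAt (by norm_num)), heq]
  unfold chi
  field_simp
  ring

/-- nonlinear density -/
def MM {n : ℕ} (b p : ℝ) (φ : Spacetime n → ℝ) (q : Spacetime n) : ℝ :=
  NN q ^ (1 + 2 * b) * |φ q| ^ (p + 1)

lemma MM_props {n : ℕ} {b p : ℝ} {φ : Spacetime n → ℝ} {q : Spacetime n} (hp : 1 ≤ p) (hN : 0 < NN q)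
    (h : DifferentiableAt ℝ φ q) :
    DifferentiableAt ℝ (MM b p φ) q ∧
    fderiv ℝ (MM b p φ) q q = (2 - 2 * b * (p - 1)) * MM b p φ q
      + (p + 1) * (NN q * NN q ^ b * (|φ q| ^ (p - 1) * φ q)) * SS (chi b φ) q ∧
    chi b φ q * (NN q * NN q ^ b * (|φ q| ^ (p - 1) * φ q)) = MM b p φ q := by
  obtain ⟨L, hL, hL'⟩ := hasFDerivAt_NNpow hN (1 + 2 * b)
  have h1 := (hasDerivAt_abs_rpow (φ q) (p := p + 1) (by linarith)).comp_hasFDerivAt q h.hasFDerivAt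
  have H : HasFDerivAt (MM b p φ) _ q := hL.mul h1
  have hpw : |φ q| ^ (p + 1) = |φ q| ^ (p - 1) * (φ q * φ q) := by
    rw [← abs_mul_abs_self (φ q), ← mul_assoc]
    rcases eq_or_ne (φ q) 0 with h0 | h0
    · rw [h0, abs_zero, Real.zero_rpow (by linarith)]; ring
    · have := abs_pos.mpr h0
      rw [← Real.rpow_add_one this.ne', ← Real.rpow_add_one this.ne']; congr 1; ring
  have hNb : NN q ^ (1 + 2 * b) = NN q * (NN q ^ b * NN q ^ b) := by
    rw [Real.rpow_add hN, Real.rpow_one, two_mul, Real.rpow_add hN]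
  refine ⟨H.differentiableAt, ?_, ?_⟩
  · rw [H.fderiv, SS_chi hN h]
    simp only [_root_.add_apply, _root_.smul_apply, smul_eq_mul, hL', fderiv_NN_self, MM]
    rw [show p + 1 - 2 = p - 1 by ring, hpw, hNb]
    unfold SS
    field_simp
    ring
  · unfold chi MM
    rw [hpw, hNb]; ring

def ca (x : ℝ) : ℝ := Real.smoothTransition (1 - x ^ 2)
lemma ca_contDiff : ContDiff ℝ 3 ca := by
  unfold ca
  exact (Real.smoothTransition.contDiff (n := 3)).comp (contDiff_const.sub (contDiff_id.pow 2))
lemma ca_nonneg (x : ℝ) : 0 ≤ ca x := Real.smoothTransition.nonneg _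
lemma ca_le_one (x : ℝ) : ca x ≤ 1 := Real.smoothTransition.le_one _
lemma ca_zero {x : ℝ} (h : 1 ≤ |x|) : ca x = 0 := by
  apply Real.smoothTransition.zero_of_nonpos
  have : 1 ≤ |x| ^ 2 := by nlinarith
  rw [sq_abs] at this; linarith
lemma ca_lower {x : ℝ} (h : |x| ≤ 1 / 2) : Real.smoothTransition (3 / 4) ≤ ca x := by
  apply Real.smoothTransition.monotone
  have : |x| ^ 2 ≤ (1/2)^2 := by gcongr
  rw [sq_abs] at this; linarith
def cb : ℝ → ℝ := deriv ca
lemma cb_contDiff : ContDiff ℝ 2 cb := by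
  have := ca_contDiff.iterate_deriv' 2 1
  simpa [cb] using this
lemma ca_deriv (x : ℝ) : HasDerivAt ca (cb x) x :=
  ((ca_contDiff.differentiable (by norm_num)) x).hasDerivAt
def cc : ℝ → ℝ := deriv cb
lemma cc_continuous : Continuous cc := cb_contDiff.continuous_deriv (by norm_num)
lemma cb_deriv (x : ℝ) : HasDerivAt cb (cc x) x :=
  ((cb_contDiff.differentiable (by norm_num)) x).hasDerivAt
lemma ca_cs : HasCompactSupport ca := by
  apply HasCompactSupport.intro (K := Set.Icc (-1) 1) isCompact_Icc
  intro x hx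
  apply ca_zero
  by_contra h
  push Not at h
  exact hx ⟨by linarith [(abs_lt.mp h).1], by linarith [(abs_lt.mp h).2]⟩
lemma c_bdd : ∃ C : ℝ, 0 < C ∧ (∀ x, |cb x| ≤ C) ∧ (∀ x, |cc x| ≤ C) := by
  obtain ⟨C1, h1⟩ := ca_cs.deriv.exists_bound_of_continuous cb_contDiff.continuous
  obtain ⟨C2, h2⟩ := ca_cs.deriv.deriv.exists_bound_of_continuous cc_continuous
  exact ⟨max (max C1 C2) 1, by positivity, fun x => (h1 x).trans (by simp), fun x => (h2 x).trans (by simp)⟩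
lemma cb_zero {x : ℝ} (h : 1 ≤ |x|) : cb x = 0 := by
  have hmin : IsLocalMin ca x := by
    apply Filter.Eventually.of_forall
    intro y; rw [ca_zero h]; exact ca_nonneg y
  exact hmin.deriv_eq_zero
lemma cb_nonpos {x : ℝ} (h : 0 ≤ x) : cb x ≤ 0 := by
  rcases h.eq_or_lt with rfl | h
  · have hmax : IsLocalMax ca 0 := by
      apply Filter.Eventually.of_forall
      intro y; unfold ca; apply Real.smoothTransition.monotone; nlinarith [sq_nonneg y]
    exact hmax.deriv_eq_zero.le
  · have hanti : AntitoneOn ca (Set.Ioi 0) := by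
      intro a ha b hb hab
      apply Real.smoothTransition.monotone
      simp only [Set.mem_Ioi] at ha hb
      nlinarith
    have := hanti.derivWithin_nonpos (x := x)
    rwa [derivWithin_of_isOpen isOpen_Ioi h] at this

def th {n : ℕ} (q : Spacetime n) : ℝ := Real.log (‖q.2‖ + q.1) - Real.log (‖q.2‖ - q.1)
def ell {n : ℕ} (q : Spacetime n) : ℝ := Real.log (NN q)

def ZZ {n : ℕ} (χ : Spacetime n → ℝ) (q : Spacetime n) : ℝ := ‖q.2‖ * dt χ q + q.1 * dr χ q

lemma Dom_pos {n : ℕ} {q : Spacetime n} (hq : q ∈ Dom n) :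
    0 < ‖q.2‖ + q.1 ∧ 0 < ‖q.2‖ - q.1 ∧ 0 < ‖q.2‖ := by
  have h : |q.1| < ‖q.2‖ := hq
  have := abs_lt.mp h
  exact ⟨by linarith, by linarith, by linarith [abs_nonneg q.1]⟩

lemma contDiffAt_th {n : ℕ} {q : Spacetime n} (hq : q ∈ Dom n) : ContDiffAt ℝ 2 (th (n := n)) q := by
  obtain ⟨h1, h2, h3⟩ := Dom_pos hq
  have hx : ContDiffAt ℝ 2 (fun q : Spacetime n => ‖q.2‖) q :=
    contDiffAt_snd.norm ℝ (norm_pos_iff.mp h3)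
  exact ((hx.add contDiffAt_fst).log h1.ne').sub ((hx.sub contDiffAt_fst).log h2.ne')

lemma contDiffAt_ell {n : ℕ} {q : Spacetime n} (hq : q ∈ Dom n) : ContDiffAt ℝ 2 (ell (n := n)) q :=
  contDiff_NN.contDiffAt.log (NN_pos hq).ne'

lemma fderiv_ell {n : ℕ} {q : Spacetime n} (hq : q ∈ Dom n) (v : Spacetime n) :
    NN q * fderiv ℝ (ell (n := n)) q v = fderiv ℝ (NN (n := n)) q v := by
  have H : HasFDerivAt (ell (n := n)) _ q := (hasFDerivAt_NN q).differentiableAt.hasFDerivAt.log (NN_pos hq).ne'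
  rw [H.fderiv]
  have := (NN_pos hq).ne'
  simp; field_simp

lemma fderiv_th {n : ℕ} {q : Spacetime n} (hq : q ∈ Dom n) (v : Spacetime n) :
    NN q * fderiv ℝ (th (n := n)) q v = 2 * (‖q.2‖ * v.1 - q.1 * (inner ℝ q.2 v.2 / ‖q.2‖)) := by
  obtain ⟨h1, h2, h3⟩ := Dom_pos hq
  have hx : DifferentiableAt ℝ (fun q : Spacetime n => ‖q.2‖) q :=
    (ContDiffAt.differentiableAt (n := 2) (contDiffAt_snd.norm ℝ (norm_pos_iff.mp h3)) (by norm_num))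
  have hd : fderiv ℝ (fun q : Spacetime n => ‖q.2‖) q v = inner ℝ q.2 v.2 / ‖q.2‖ := by
    have ha : HasFDerivAt (fun q : Spacetime n => ‖q.2‖ ^ 2) _ q := hx.hasFDerivAt.pow 2
    have hb : HasFDerivAt (fun q : Spacetime n => ‖q.2‖ ^ 2) _ q := (hasFDerivAt_snd (𝕜 := ℝ) (p := q)).norm_sq
    have := congrArg (fun L => L v) (ha.unique hb)
    simp at this
    field_simp
    linarith
  have H : HasFDerivAt (th (n := n)) _ q :=
    ((hx.hasFDerivAt.add hasFDerivAt_fst).log h1.ne').sub ((hx.hasFDerivAt.sub hasFDerivAt_fst).log h2.ne')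
  rw [H.fderiv]
  simp only [_root_.add_apply, _root_.sub_apply, _root_.smul_apply, smul_eq_mul, hd, ContinuousLinearMap.coe_fst', Pi.add_apply, Pi.sub_apply]
  have hNe : NN q = (‖q.2‖ + q.1) * (‖q.2‖ - q.1) := by unfold NN; ring
  rw [hNe]
  field_simp
  ring

lemma fderiv_th_self {n : ℕ} {q : Spacetime n} (hq : q ∈ Dom n) : fderiv ℝ (th (n := n)) q q = 0 := by
  have h := fderiv_th hq q
  obtain ⟨h1, h2, h3⟩ := Dom_pos hq
  have : NN q * fderiv ℝ (th (n := n)) q q = 0 := by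
    rw [h, real_inner_self_eq_norm_sq]; field_simp; ring
  exact (mul_eq_zero.mp this).resolve_left (NN_pos hq).ne'

lemma fderiv_th_Y {n : ℕ} {q : Spacetime n} (hq : q ∈ Dom n) (χ : Spacetime n → ℝ) :
    NN q * fderiv ℝ (th (n := n)) q (Yv χ q) = - 2 * ZZ χ q := by
  rw [fderiv_th hq, inner_eq_sum']
  simp only [Yv, ZZ, dr]
  ring

def eta {n : ℕ} (R : ℝ) : Spacetime n → ℝ :=
  Set.indicator (Dom n) (fun q => ca (ell q / R) * ca (th q / R))
def etas {n : ℕ} (R : ℝ) : Spacetime n → ℝ :=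
  Set.indicator (Dom n) (fun q => 2 / R * (cb (ell q / R) * ca (th q / R)))

lemma eta_ev {n : ℕ} {R : ℝ} {q : Spacetime n} (hq : q ∈ Dom n) :
    eta R =ᶠ[nhds q] (fun q => ca (ell q / R) * ca (th q / R)) := by
  filter_upwards [isOpen_Dom.mem_nhds hq] with q' h; simp [eta, h]
lemma etas_ev {n : ℕ} {R : ℝ} {q : Spacetime n} (hq : q ∈ Dom n) :
    etas R =ᶠ[nhds q] (fun q => 2 / R * (cb (ell q / R) * ca (th q / R))) := by
  filter_upwards [isOpen_Dom.mem_nhds hq] with q' h; simp [etas, h]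

lemma contDiffAt_eta {n : ℕ} {R : ℝ} {q : Spacetime n} (hq : q ∈ Dom n) : ContDiffAt ℝ 2 (eta (n := n) R) q := by
  refine ContDiffAt.congr_of_eventuallyEq ?_ (eta_ev hq)
  have h3 : ContDiff ℝ 2 ca := ca_contDiff.of_le (by norm_num)
  exact (h3.contDiffAt.comp q ((contDiffAt_ell hq).div_const R)).mul (h3.contDiffAt.comp q ((contDiffAt_th hq).div_const R))
lemma contDiffAt_etas {n : ℕ} {R : ℝ} {q : Spacetime n} (hq : q ∈ Dom n) : ContDiffAt ℝ 2 (etas (n := n) R) q := by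
  refine ContDiffAt.congr_of_eventuallyEq ?_ (etas_ev hq)
  have h3 : ContDiff ℝ 2 ca := ca_contDiff.of_le (by norm_num)
  exact contDiffAt_const.mul ((cb_contDiff.contDiffAt.comp q ((contDiffAt_ell hq).div_const R)).mul (h3.contDiffAt.comp q ((contDiffAt_th hq).div_const R)))

lemma fderiv_cut {n : ℕ} {R : ℝ} {q : Spacetime n} (hq : q ∈ Dom n) {f g f' g' : ℝ → ℝ}
    (hf : ∀ x, HasDerivAt f (f' x) x) (hg : ∀ x, HasDerivAt g (g' x) x) (v : Spacetime n) :
    fderiv ℝ (fun q : Spacetime n => f (ell q / R) * g (th q / R)) q v =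
      1 / R * (f' (ell q / R) * g (th q / R) * fderiv ℝ (ell (n := n)) q v
        + f (ell q / R) * g' (th q / R) * fderiv ℝ (th (n := n)) q v) := by
  have h1 := (((contDiffAt_ell hq).differentiableAt (by norm_num)).hasFDerivAt.mul_const (R⁻¹))
  have h2 := (((contDiffAt_th hq).differentiableAt (by norm_num)).hasFDerivAt.mul_const (R⁻¹))
  have H : HasFDerivAt (fun q : Spacetime n => f (ell q * R⁻¹) * g (th q * R⁻¹)) _ q :=
    ((hf (ell q * R⁻¹)).comp_hasFDerivAt q h1).mul ((hg (th q * R⁻¹)).comp_hasFDerivAt q h2)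
  simp only [div_eq_mul_inv]
  rw [H.fderiv]
  simp only [_root_.add_apply, _root_.smul_apply, smul_eq_mul, Function.comp]
  ring

lemma fderiv_eta_self {n : ℕ} {R : ℝ} {q : Spacetime n} (hq : q ∈ Dom n) :
    fderiv ℝ (eta (n := n) R) q q = etas R q := by
  rw [(eta_ev hq).fderiv_eq, fderiv_cut hq ca_deriv ca_deriv, fderiv_th_self hq]
  have h := fderiv_ell hq q
  rw [fderiv_NN_self] at h
  have : fderiv ℝ (ell (n := n)) q q = 2 := by
    have := NN_pos hq
    apply mul_left_cancel₀ this.ne'; linarith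
  rw [this]; simp [etas, hq]; ring

lemma fderiv_eta_Y {n : ℕ} {R : ℝ} {q : Spacetime n} (hq : q ∈ Dom n) (χ : Spacetime n → ℝ) :
    NN q * fderiv ℝ (eta (n := n) R) q (Yv χ q) = 2 / R * (cb (ell q / R) * ca (th q / R) * SS χ q
      - ca (ell q / R) * cb (th q / R) * ZZ χ q) := by
  rw [(eta_ev hq).fderiv_eq, fderiv_cut hq ca_deriv ca_deriv]
  have h1 := fderiv_ell hq (Yv χ q)
  have h2 := fderiv_th_Y hq χ
  rw [fderiv_NN_Y] at h1
  unfold SS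
  linear_combination 1 / R * (cb (ell q / R) * ca (th q / R)) * h1 + 1 / R * ca (ell q / R) * cb (th q / R) * h2

lemma fderiv_etas_Y {n : ℕ} {R : ℝ} {q : Spacetime n} (hq : q ∈ Dom n) (χ : Spacetime n → ℝ) :
    NN q * fderiv ℝ (etas (n := n) R) q (Yv χ q) = 4 / R ^ 2 * (cc (ell q / R) * ca (th q / R) * SS χ q
      - cb (ell q / R) * cb (th q / R) * ZZ χ q) := by
  rw [(etas_ev hq).fderiv_eq]
  have hd : DifferentiableAt ℝ (fun q : Spacetime n => cb (ell q / R) * ca (th q / R)) q := by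
    have h3 : ContDiff ℝ 2 ca := ca_contDiff.of_le (by norm_num)
    exact (((cb_contDiff.contDiffAt.comp q ((contDiffAt_ell hq).div_const R)).mul (h3.contDiffAt.comp q ((contDiffAt_th hq).div_const R)))).differentiableAt (by norm_num)
  rw [(hd.hasFDerivAt.const_mul (2 / R)).fderiv, _root_.smul_apply, fderiv_cut hq cb_deriv ca_deriv]
  have h1 := fderiv_ell hq (Yv χ q)
  have h2 := fderiv_th_Y hq χ
  rw [fderiv_NN_Y] at h1
  unfold SS
  rw [smul_eq_mul]
  linear_combination 2 / R ^ 2 * (cc (ell q / R) * ca (th q / R)) * h1 + 2 / R ^ 2 * cb (ell q / R) * cb (th q / R) * h2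

lemma lintegral_polar {E : Type*} [NormedAddCommGroup E] [NormedSpace ℝ E] [MeasurableSpace E]
    [Nontrivial E] (μ : Measure E) [FiniteDimensional ℝ E] [BorelSpace E] [μ.IsAddHaarMeasure]
    (f : ℝ → ENNReal) (hf : Measurable f) :
    ∫⁻ x, f ‖x‖ ∂μ = μ.toSphere Set.univ *
      ∫⁻ r in Set.Ioi (0:ℝ), ENNReal.ofReal (r ^ (Module.finrank ℝ E - 1)) * f r := by
  have h1 : ∫⁻ x, f ‖x‖ ∂μ = ∫⁻ x : ({(0)}ᶜ : Set E), f (‖x.1‖) ∂(μ.comap (↑)) := by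
    rw [lintegral_subtype_comap (measurableSet_singleton _).compl (fun x ↦ f (‖x‖)),
        restrict_compl_singleton]
  have h2 : ∫⁻ x : ({(0)}ᶜ : Set E), f (‖x.1‖) ∂(μ.comap (↑))
      = ∫⁻ x, f x.2 ∂(μ.toSphere.prod (Measure.volumeIoiPow (Module.finrank ℝ E - 1))) := by
    have := μ.measurePreserving_homeomorphUnitSphereProd.lintegral_comp_emb
        (Homeomorph.measurableEmbedding _) (f ∘ Subtype.val ∘ Prod.snd)
    simpa using this
  have hm : Measurable (fun x : Set.Ioi (0:ℝ) => f x) := hf.comp measurable_subtype_coe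
  have hfst : AEMeasurable (fun x : (Metric.sphere (0:E) 1) × Set.Ioi (0:ℝ) => f x.2)
      (μ.toSphere.prod (Measure.volumeIoiPow (Module.finrank ℝ E - 1))) :=
    (hm.comp measurable_snd).aemeasurable
  rw [h1, h2, lintegral_prod _ hfst]
  dsimp only
  rw [lintegral_const, mul_comm]
  congr 1
  unfold Measure.volumeIoiPow
  rw [lintegral_withDensity_eq_lintegral_mul _ (by fun_prop) hm]
  exact lintegral_subtype_comap measurableSet_Ioi (fun r => ENNReal.ofReal (r ^ (Module.finrank ℝ E - 1)) * f r)

def hh (ε δ : ℝ) : ℝ → ENNReal :=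
  Set.indicator (Set.Ioi 0) (fun y => ENNReal.ofReal (y ^ (ε - 1) * (1 + y / 2) ^ (-δ)))

lemma hh_meas (ε δ : ℝ) : Measurable (hh ε δ) := by
  unfold hh
  exact Measurable.indicator (by fun_prop) measurableSet_Ioi

lemma hh_fin {ε δ : ℝ} (hε : 0 < ε) (hδ : ε < δ) : ∫⁻ y, hh ε δ y ≠ ⊤ := by
  unfold hh
  rw [lintegral_indicator measurableSet_Ioi]
  have hm : Measurable (fun y : ℝ => y ^ (ε - 1) * (1 + y / 2) ^ (-δ)) := by fun_prop
  have hi : IntegrableOn (fun y : ℝ => y ^ (ε - 1) * (1 + y / 2) ^ (-δ)) (Set.Ioi 0) := by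
    rw [← Set.Ioc_union_Ioi_eq_Ioi (zero_le_one (α := ℝ))]
    apply IntegrableOn.union
    · have h1 : IntegrableOn (fun y : ℝ => y ^ (ε - 1)) (Set.Ioc 0 1) := by
        rw [integrableOn_Ioc_iff_integrableOn_Ioo, intervalIntegral.integrableOn_Ioo_rpow_iff one_pos]
        linarith
      refine Integrable.mono' h1 hm.aestronglyMeasurable ?_
      refine (ae_restrict_mem measurableSet_Ioc).mono (fun y hy => ?_)
      have hy0 : 0 < y := hy.1
      rw [Real.norm_of_nonneg (by positivity)]
      refine mul_le_of_le_one_right (by positivity) ?_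
      exact Real.rpow_le_one_of_one_le_of_nonpos (by linarith) (by linarith)
    · have h1 : IntegrableOn (fun y : ℝ => y ^ (ε - 1 - δ) * 2 ^ δ) (Set.Ioi 1) :=
        (integrableOn_Ioi_rpow_of_lt (by linarith) one_pos).mul_const _
      refine Integrable.mono' h1 hm.aestronglyMeasurable ?_
      refine (ae_restrict_mem measurableSet_Ioi).mono (fun y hy => ?_)
      have hy0 : 0 < y := lt_trans one_pos hy
      rw [Real.norm_of_nonneg (by positivity)]
      have h2 : (1 + y / 2) ^ (-δ) ≤ (y / 2) ^ (-δ) :=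
        Real.rpow_le_rpow_of_nonpos (by positivity) (by linarith) (by linarith)
      have h3 : (y / 2) ^ (-δ) = y ^ (-δ) * 2 ^ δ := by
        rw [Real.div_rpow hy0.le (by norm_num), Real.rpow_neg (by norm_num : (0:ℝ) ≤ 2)]; field_simp
      calc y ^ (ε - 1) * (1 + y / 2) ^ (-δ) ≤ y ^ (ε - 1) * (y ^ (-δ) * 2 ^ δ) := by
            rw [← h3]; gcongr
        _ = y ^ (ε - 1 - δ) * 2 ^ δ := by rw [sub_eq_add_neg (ε - 1) δ, Real.rpow_add hy0]; ring
  have := hi.lintegral_lt_top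
  exact this.ne

lemma hh2_fin {ε δ : ℝ} (hε : 0 < ε) (hδ : ε < δ) :
    ∫⁻ t : ℝ, ∫⁻ r : ℝ, hh ε δ (r - t) * hh ε δ (r + t) ≠ ⊤ := by
  have hm := hh_meas ε δ
  have h1 : ∀ t : ℝ, ∫⁻ r : ℝ, hh ε δ (r - t) * hh ε δ (r + t) = ∫⁻ y : ℝ, hh ε δ y * hh ε δ (y + 2 * t) := by
    intro t
    rw [← lintegral_add_right_eq_self (fun r => hh ε δ (r - t) * hh ε δ (r + t)) t]
    refine lintegral_congr (fun y => ?_)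
    congr 2 <;> ring
  simp_rw [h1]
  rw [lintegral_lintegral_swap (by fun_prop)]
  have h2 : ∀ y : ℝ, ∫⁻ t : ℝ, hh ε δ y * hh ε δ (y + 2 * t) = hh ε δ y * (ENNReal.ofReal |(2:ℝ)⁻¹| * ∫⁻ s, hh ε δ s) := by
    intro y
    rw [lintegral_const_mul _ (by fun_prop)]
    congr 1
    have h3 : ∫⁻ s, hh ε δ (y + s) ∂(Measure.map ((2:ℝ) * ·) volume) = ∫⁻ t, hh ε δ (y + 2 * t) :=
      lintegral_map (by fun_prop) (by fun_prop)
    rw [← h3, Real.map_volume_mul_left (by norm_num), lintegral_smul_measure, lintegral_add_left_eq_self]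
    rfl
  simp_rw [h2]
  rw [lintegral_mul_const _ hm]
  have := hh_fin hε hδ
  exact ENNReal.mul_ne_top this (ENNReal.mul_ne_top ENNReal.ofReal_ne_top this)

def pw {n : ℕ} (q : Spacetime n) : ℝ := (1 + |uu q|) * (1 + |vv q|)

def gg {n : ℕ} (ε δ : ℝ) : Spacetime n → ℝ :=
  Set.indicator (Dom n) (fun q => (‖q.2‖ ^ 2 - q.1 ^ 2) ^ (ε - 1) * pw q ^ (-((n : ℝ) - 1 + δ)))

def GG (n : ℕ) (ε δ : ℝ) (t r : ℝ) : ENNReal :=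
  Set.indicator {z : ℝ × ℝ | |z.1| < z.2} (fun z => ENNReal.ofReal ((z.2 ^ 2 - z.1 ^ 2) ^ (ε - 1) *
    ((1 + |(z.1 - z.2) / 2|) * (1 + |(z.1 + z.2) / 2|)) ^ (-((n : ℝ) - 1 + δ)))) (t, r)

lemma GG_le {n : ℕ} (hn : 2 ≤ n) {ε δ : ℝ} (t r : ℝ) :
    ENNReal.ofReal (r ^ (n - 1)) * GG n ε δ t r ≤ hh ε δ (r - t) * hh ε δ (r + t) := by
  by_cases h : |t| < r
  · have h' := abs_lt.mp h
    have a1 : 0 < r - t := by linarith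
    have a2 : 0 < r + t := by linarith
    have hr : 0 < r := by linarith
    have e1 : |(t - r) / 2| = (r - t) / 2 := by rw [abs_of_neg (by linarith)]; ring
    have e2 : |(t + r) / 2| = (r + t) / 2 := by rw [abs_of_pos (by linarith)]; ring
    have hmem : (t, r) ∈ {z : ℝ × ℝ | |z.1| < z.2} := h
    unfold GG hh
    rw [Set.indicator_of_mem hmem, Set.indicator_of_mem (show r - t ∈ Set.Ioi 0 from a1),
      Set.indicator_of_mem (show r + t ∈ Set.Ioi 0 from a2)]
    simp only [e1, e2]
    rw [← ENNReal.ofReal_mul (by positivity), ← ENNReal.ofReal_mul (by positivity)]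
    apply ENNReal.ofReal_le_ofReal
    have e3 : (r ^ 2 - t ^ 2) ^ (ε - 1) = (r - t) ^ (ε - 1) * (r + t) ^ (ε - 1) := by
      rw [← Real.mul_rpow a1.le a2.le]; congr 1; ring
    set P := (1 + (r - t) / 2) * (1 + (r + t) / 2) with hP
    have hP0 : 0 < P := by positivity
    have hPr : r ≤ P := by rw [hP]; nlinarith [mul_pos a1 a2]
    have e4 : P ^ (-((n : ℝ) - 1 + δ)) = (P ^ (n - 1))⁻¹ * ((1 + (r - t) / 2) ^ (-δ) * (1 + (r + t) / 2) ^ (-δ)) := by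
      rw [← Real.mul_rpow (by positivity) (by positivity), ← hP, ← Real.rpow_natCast, ← Real.rpow_neg hP0.le,
        ← Real.rpow_add hP0]
      congr 1
      push_cast [Nat.cast_sub (show 1 ≤ n by omega)]
      ring
    rw [e3, e4]
    have e5 : r ^ (n - 1) * (P ^ (n - 1))⁻¹ ≤ 1 := by
      rw [← div_eq_mul_inv, div_le_one (by positivity)]; gcongr
    have : 0 ≤ (r - t) ^ (ε - 1) * (r + t) ^ (ε - 1) * ((1 + (r - t) / 2) ^ (-δ) * (1 + (r + t) / 2) ^ (-δ)) := by positivity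
    nlinarith
  · have hmem : (t, r) ∉ {z : ℝ × ℝ | |z.1| < z.2} := h
    unfold GG
    rw [Set.indicator_of_notMem hmem]; simp

lemma gg_integrable {n : ℕ} (hn : 2 ≤ n) {ε δ : ℝ} (hε : 0 < ε) (hδ : ε < δ) :
    Integrable (gg (n := n) ε δ) := by
  have hD : MeasurableSet (Dom n) :=
    measurableSet_lt (by fun_prop) (by fun_prop)
  have hm : Measurable (gg (n := n) ε δ) := by
    unfold gg pw uu vv
    exact Measurable.indicator (by fun_prop) hD
  have hGm : Measurable (fun z : ℝ × ℝ => GG n ε δ z.1 z.2) := by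
    unfold GG
    exact Measurable.indicator (by fun_prop) (measurableSet_lt (by fun_prop) (by fun_prop))
  refine ⟨hm.aestronglyMeasurable, ?_⟩
  rw [hasFiniteIntegral_iff_enorm]
  have he : ∀ q : Spacetime n, ‖gg ε δ q‖ₑ = GG n ε δ q.1 ‖q.2‖ := by
    intro q
    unfold gg GG
    by_cases h : q ∈ Dom n
    · have h1 : (q.1, ‖q.2‖) ∈ {z : ℝ × ℝ | |z.1| < z.2} := h
      have h2 : 0 ≤ ‖q.2‖ ^ 2 - q.1 ^ 2 := by
        have h0 : |q.1| < ‖q.2‖ := h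
        have := sq_lt_sq' (by linarith [abs_nonneg q.1, norm_nonneg q.2]) h0
        rw [sq_abs] at this; linarith
      rw [Set.indicator_of_mem h, Set.indicator_of_mem h1, Real.enorm_eq_ofReal]
      · rfl
      · unfold pw; positivity
    · have h1 : (q.1, ‖q.2‖) ∉ {z : ℝ × ℝ | |z.1| < z.2} := h
      rw [Set.indicator_of_notMem h, Set.indicator_of_notMem h1]; simp
  simp_rw [he]
  have : Nontrivial (EuclideanSpace ℝ (Fin n)) := by
    have : Nonempty (Fin n) := ⟨⟨0, by omega⟩⟩
    infer_instance
  have hvol : (volume : Measure (Spacetime n)) = (volume : Measure ℝ).prod volume := rfl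
  rw [hvol, lintegral_prod _ (by
    exact (hGm.comp (measurable_fst.prodMk measurable_snd.norm)).aemeasurable)]
  have hp : ∀ t : ℝ, ∫⁻ x : EuclideanSpace ℝ (Fin n), GG n ε δ t ‖x‖ ≤
      (volume : Measure (EuclideanSpace ℝ (Fin n))).toSphere Set.univ * ∫⁻ r : ℝ, hh ε δ (r - t) * hh ε δ (r + t) := by
    intro t
    rw [lintegral_polar volume (fun r => GG n ε δ t r) (hGm.comp (measurable_const.prodMk measurable_id))]
    refine mul_le_mul' le_rfl ?_
    rw [finrank_euclideanSpace_fin]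
    refine (setLIntegral_le_lintegral _ _).trans (lintegral_mono (fun r => GG_le hn t r))
  refine lt_of_le_of_lt (lintegral_mono hp) ?_
  have hhm := hh_meas ε δ
  rw [lintegral_const_mul' _ _ (measure_ne_top _ _)]
  exact (ENNReal.mul_ne_top (measure_ne_top _ _) (hh2_fin hε hδ)).lt_top

lemma ZZ_chi {n : ℕ} {b : ℝ} {φ : Spacetime n → ℝ} {q : Spacetime n} (hq : q ∈ Dom n)
    (h : DifferentiableAt ℝ φ q) :
    ZZ (chi b φ) q = NN q ^ b * ZZ φ q := by
  have hN := NN_pos hq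
  obtain ⟨-, -, h3⟩ := Dom_pos hq
  have e0 : dt (chi b φ) q = NN q ^ b * dt φ q + b * NN q ^ b / NN q * (- 2 * q.1) * φ q := by
    unfold dt
    rw [fderiv_chi hN h, fderiv_NN]; simp
  have ei : ∀ i, dx i (chi b φ) q = NN q ^ b * dx i φ q + b * NN q ^ b / NN q * (2 * q.2 i) * φ q := by
    intro i
    unfold dx
    rw [fderiv_chi hN h, fderiv_NN]; simp [EuclideanSpace.inner_single_right]
  have er : dr (chi b φ) q = NN q ^ b * dr φ q + b * NN q ^ b / NN q * (2 * ‖q.2‖) * φ q := by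
    unfold dr
    have : ∑ i, q.2 i * dx i (chi b φ) q = NN q ^ b * (∑ i, q.2 i * dx i φ q)
        + b * NN q ^ b / NN q * 2 * φ q * (∑ i, q.2 i * q.2 i) := by
      rw [Finset.mul_sum, Finset.mul_sum, ← Finset.sum_add_distrib]
      refine Finset.sum_congr rfl (fun i _ => ?_)
      rw [ei]; ring
    rw [this, ← inner_eq_sum', real_inner_self_eq_norm_sq]
    field_simp
  unfold ZZ
  rw [e0, er]
  ring

lemma SS_uv {n : ℕ} {φ : Spacetime n → ℝ} {q : Spacetime n} (hq : q ∈ Dom n) :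
    SS φ q = uu q * du φ q + vv q * dv φ q := by
  obtain ⟨-, -, h3⟩ := Dom_pos hq
  unfold SS
  rw [clm_expand]
  have : ∑ i, q.2 i * fderiv ℝ φ q (0, EuclideanSpace.single i 1) = ‖q.2‖ * dr φ q := by
    unfold dr dx; field_simp
  rw [this]
  unfold uu vv du dv dt
  ring

lemma ZZ_uv {n : ℕ} {φ : Spacetime n → ℝ} {q : Spacetime n} :
    ZZ φ q = vv q * dv φ q - uu q * du φ q := by
  unfold ZZ uu vv du dv
  ring

lemma pw_one {n : ℕ} (q : Spacetime n) : 1 ≤ pw q := by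
  unfold pw
  nlinarith [abs_nonneg (uu q), abs_nonneg (vv q), mul_nonneg (abs_nonneg (uu q)) (abs_nonneg (vv q))]

lemma NN_le_pw {n : ℕ} (q : Spacetime n) : NN q ≤ 4 * pw q := by
  have h1 : NN q = - 4 * (uu q * vv q) := by unfold NN uu vv; ring
  have h2 : - (uu q * vv q) ≤ |uu q| * |vv q| := by rw [← abs_mul]; exact neg_le_abs _
  unfold pw
  nlinarith [abs_nonneg (uu q), abs_nonneg (vv q)]

lemma dec_bounds {n : ℕ} {δ : ℝ} {φ : Spacetime n → ℝ} (h : Dec δ φ) :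
    ∃ C : ℝ, 0 < C ∧ ∀ q ∈ Dom n, |φ q| ≤ C * pw q ^ (-(((n : ℝ) - 1 + δ) / 2)) ∧
      |SS φ q| ≤ C * pw q ^ (-(((n : ℝ) - 1 + δ) / 2)) ∧
      |ZZ φ q| ≤ C * pw q ^ (-(((n : ℝ) - 1 + δ) / 2)) := by
  obtain ⟨⟨C1, h1⟩, -, ⟨C2, h2⟩⟩ := h
  refine ⟨max (max C1 C2) 1, by positivity, fun q hq => ?_⟩
  have hp : 0 < pw q := lt_of_lt_of_le one_pos (pw_one q)
  have a1 := (h1 q hq).trans ((le_max_left C1 C2).trans (le_max_left _ 1))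
  have a2 := (h2 q hq).trans ((le_max_right C1 C2).trans (le_max_left _ 1))
  change pw q ^ _ * _ ≤ _ at a1 a2
  rw [Real.rpow_neg hp.le, ← div_eq_mul_inv]
  have hpp : 0 < pw q ^ (((n : ℝ) - 1 + δ) / 2) := by positivity
  rw [le_div_iff₀' hpp, le_div_iff₀' hpp, le_div_iff₀' hpp]
  refine ⟨a2, ?_, ?_⟩
  · refine le_trans ?_ a1
    rw [SS_uv hq]
    gcongr
    exact abs_add_le _ _
  · refine le_trans ?_ a1
    rw [ZZ_uv]
    gcongr
    rw [add_comm]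
    exact abs_sub _ _

lemma weight_bound {n : ℕ} {δ ε C : ℝ} {φ : Spacetime n → ℝ} {q : Spacetime n} (hq : q ∈ Dom n)
    (hd : DifferentiableAt ℝ φ q)
    {b : ℝ} (hb : b = (((n : ℝ) - 1) / 2 + ε) / 2)
    (h : |φ q| ≤ C * pw q ^ (-(((n : ℝ) - 1 + δ) / 2)) ∧
      |SS φ q| ≤ C * pw q ^ (-(((n : ℝ) - 1 + δ) / 2)) ∧
      |ZZ φ q| ≤ C * pw q ^ (-(((n : ℝ) - 1 + δ) / 2))) :
    Wt q * (chi b φ q ^ 2 + SS (chi b φ) q ^ 2 + ZZ (chi b φ) q ^ 2) ≤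
      C ^ 2 * (4 + 8 * b ^ 2) * gg ε δ q := by
  have hN := NN_pos hq
  have hp : 0 < pw q := lt_of_lt_of_le one_pos (pw_one q)
  set w := pw q ^ (-(((n : ℝ) - 1 + δ) / 2)) with hw
  have hw2 : w ^ 2 = pw q ^ (-((n : ℝ) - 1 + δ)) := by
    rw [hw, ← Real.rpow_natCast, ← Real.rpow_mul hp.le]; congr 1; push_cast; ring
  have hWN : Wt q * (NN q ^ b) ^ 2 = NN q ^ (ε - 1) := by
    unfold Wt
    rw [← Real.rpow_natCast, ← Real.rpow_mul hN.le, ← Real.rpow_add hN]; congr 1; rw [hb]; push_cast; ring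
  have hg : gg ε δ q = NN q ^ (ε - 1) * w ^ 2 := by
    rw [hw2]; unfold gg; rw [Set.indicator_of_mem hq]; rfl
  rw [SS_chi hN hd, ZZ_chi hq hd, hg, ← hWN]
  unfold chi
  obtain ⟨h1, h2, h3⟩ := h
  have s1 := sq_le_sq' (abs_le.mp h1).1 (abs_le.mp h1).2
  have s2 := sq_le_sq' (abs_le.mp h2).1 (abs_le.mp h2).2
  have s3 := sq_le_sq' (abs_le.mp h3).1 (abs_le.mp h3).2
  have hWt : 0 ≤ Wt q := by unfold Wt; positivity
  have key : φ q ^ 2 + (SS φ q + 2 * b * φ q) ^ 2 + ZZ φ q ^ 2 ≤ C ^ 2 * (4 + 8 * b ^ 2) * w ^ 2 := by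
    have : (SS φ q + 2 * b * φ q) ^ 2 ≤ 2 * SS φ q ^ 2 + 8 * b ^ 2 * φ q ^ 2 := by
      nlinarith [sq_nonneg (SS φ q - 2 * b * φ q)]
    have : 8 * b ^ 2 * φ q ^ 2 ≤ 8 * b ^ 2 * (C * w) ^ 2 := by gcongr 8 * b ^ 2 * ?_
    nlinarith
  have hc : 0 ≤ Wt q * (NN q ^ b) ^ 2 := by positivity
  have := mul_le_mul_of_nonneg_left key hc
  linarith

lemma M_bound {n : ℕ} {δ C σ p b : ℝ} {φ : Spacetime n → ℝ} (hδ : 0 < δ) (hp : 1 ≤ p) (hn : 2 ≤ n)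
    (hC : 0 < C)
    (h : ∀ q ∈ Dom n, |φ q| ≤ C * pw q ^ (-(((n : ℝ) - 1 + δ) / 2)))
    (hσ : σ = 1 ∨ (σ = -1 ∧ 4 ≤ ((n : ℝ) - 1) * (p - 1))) :
    ∃ K : ℝ, 0 ≤ K ∧ ∀ R : ℝ, 1 ≤ R → ∀ q ∈ Dom n,
      - (K / R * chi b φ q ^ 2) ≤ etas R q * (σ * (1 / (p + 1) - 1 / 2) * MM b p φ q) := by
  obtain ⟨D, hD, hcb, -⟩ := c_bdd
  have hn' : (2:ℝ) ≤ n := by exact_mod_cast hn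
  refine ⟨D * (4 * C ^ (p - 1)), by positivity, fun R hR q hq => ?_⟩
  have hR0 : 0 < R := by linarith
  have hN := NN_pos hq
  have hpw := pw_one q
  have hpw0 : 0 < pw q := by linarith
  have hM : MM b p φ q = chi b φ q ^ 2 * (NN q * |φ q| ^ (p - 1)) := by
    have hpw : |φ q| ^ (p + 1) = |φ q| ^ (p - 1) * (φ q ^ 2) := by
      rw [← sq_abs (φ q), ← Real.rpow_natCast |φ q| 2, ← Real.rpow_add_of_nonneg (abs_nonneg _) (by linarith) (by norm_num)]
      congr 1; push_cast; ring
    unfold MM chi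
    rw [hpw, Real.rpow_add hN, Real.rpow_one, two_mul, Real.rpow_add hN]
    ring
  have hc1 : 0 ≤ 1 / 2 - 1 / (p + 1) := by
    rw [sub_nonneg]; apply one_div_le_one_div_of_le <;> linarith
  have hc2 : 1 / 2 - 1 / (p + 1) ≤ 1 / 2 := by
    have : 0 < 1 / (p + 1) := by positivity
    linarith
  have hes : etas R q = 2 / R * (cb (ell q / R) * ca (th q / R)) := by
    unfold etas; rw [Set.indicator_of_mem hq]
  have ha0 := ca_nonneg (th q / R)
  have ha1 := ca_le_one (th q / R)
  have hmain : NN q * |φ q| ^ (p - 1) ≤ 4 * C ^ (p - 1) →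
      |σ| = 1 → - (D * (4 * C ^ (p - 1)) / R * chi b φ q ^ 2) ≤ etas R q * (σ * (1 / (p + 1) - 1 / 2) * MM b p φ q) := by
    intro hK hs
    have habs : |etas R q * (σ * (1 / (p + 1) - 1 / 2) * MM b p φ q)| ≤ D * (4 * C ^ (p - 1)) / R * chi b φ q ^ 2 := by
      rw [hM, hes]
      have e1 : |1 / (p + 1) - 1 / 2| ≤ 1 / 2 := by rw [abs_sub_comm, abs_of_nonneg hc1]; exact hc2
      have e2 : |cb (ell q / R)| ≤ D := hcb _
      have e3 : |ca (th q / R)| ≤ 1 := by rw [abs_of_nonneg ha0]; exact ha1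
      have e4 : |NN q * |φ q| ^ (p - 1)| ≤ 4 * C ^ (p - 1) := by rwa [abs_of_nonneg (by positivity)]
      rw [abs_mul, abs_mul, abs_mul, abs_mul, abs_mul, abs_mul, hs, abs_of_nonneg (sq_nonneg (chi b φ q)),
        abs_of_pos (show 0 < 2 / R by positivity)]
      calc 2 / R * (|cb (ell q / R)| * |ca (th q / R)|) * (1 * |1 / (p + 1) - 1 / 2| * (chi b φ q ^ 2 * |NN q * |φ q| ^ (p - 1)|))
          ≤ 2 / R * (D * 1) * (1 * (1 / 2) * (chi b φ q ^ 2 * (4 * C ^ (p - 1)))) := by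
            gcongr
        _ = _ := by ring
    exact (abs_le.mp habs).1
  have hw1 : pw q ^ (-(((n : ℝ) - 1 + δ) / 2)) ≤ 1 := by
    apply Real.rpow_le_one_of_one_le_of_nonpos hpw; linarith
  rcases hσ with rfl | ⟨rfl, h4⟩
  · by_cases hN1 : 1 ≤ NN q
    · have hl : 0 ≤ ell q / R := div_nonneg (Real.log_nonneg hN1) hR0.le
      have hcbn := cb_nonpos hl
      have : 0 ≤ MM b p φ q := by unfold MM; positivity
      have e5 : etas R q ≤ 0 := by
        rw [hes]
        exact mul_nonpos_of_nonneg_of_nonpos (by positivity) (mul_nonpos_of_nonpos_of_nonneg hcbn ha0)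
      have e6 : 0 ≤ etas R q * (1 * (1 / (p + 1) - 1 / 2) * MM b p φ q) :=
        mul_nonneg_of_nonpos_of_nonpos e5 (mul_nonpos_of_nonpos_of_nonneg (by linarith) this)
      refine le_trans ?_ e6
      rw [neg_nonpos]; positivity
    · apply hmain _ (by simp)
      have e1 : |φ q| ≤ C := (h q hq).trans (mul_le_of_le_one_right hC.le hw1)
      calc NN q * |φ q| ^ (p - 1) ≤ 1 * C ^ (p - 1) := by
            push Not at hN1
            have : 0 ≤ p - 1 := by linarith
            gcongr
        _ ≤ 4 * C ^ (p - 1) := by gcongr; norm_num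
  · apply hmain _ (by simp)
    have : 0 ≤ p - 1 := by linarith
    calc NN q * |φ q| ^ (p - 1) ≤ (4 * pw q) * (C * pw q ^ (-(((n : ℝ) - 1 + δ) / 2))) ^ (p - 1) := by
          have := NN_le_pw q
          have := h q hq
          gcongr
      _ = 4 * C ^ (p - 1) * pw q ^ (1 + (-(((n : ℝ) - 1 + δ) / 2)) * (p - 1)) := by
          rw [Real.mul_rpow hC.le (by positivity), ← Real.rpow_mul hpw0.le, Real.rpow_add hpw0, Real.rpow_one]; ring
      _ ≤ 4 * C ^ (p - 1) * 1 := by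
          gcongr
          apply Real.rpow_le_one_of_one_le_of_nonpos hpw
          nlinarith [mul_nonneg hδ.le this]
      _ = _ := by ring

set_option maxHeartbeats 2000000 in
lemma alg_bound {R D ε K a1 a2 b1 b2 c1 S Z X κM T3 η : ℝ} (hR : 1 ≤ R) (hε : 0 < ε) (hD : 0 < D) (hη : 0 ≤ η)
    (h1 : |a1| ≤ 1) (h2 : |a2| ≤ 1) (h3 : |b1| ≤ D) (h4 : |b2| ≤ D) (h5 : |c1| ≤ D) (hK : 0 ≤ K)
    (hT : - (K / R * X ^ 2) ≤ T3) :
    η * κM - (6 * D + 2 * D * ε + K + 2 * D ^ 2) / R * (X ^ 2 + S ^ 2 + Z ^ 2) ≤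
    η * (2 * ε * S ^ 2 + κM) + 2 / R * (b1 * a2 * S - a1 * b2 * Z) * S
      + 2 / R * (b1 * a2) * (ε * X * S) + T3
      + 1 / 2 * (4 / R ^ 2 * (c1 * a2 * S - b1 * b2 * Z)) * X := by
  set Q := X ^ 2 + S ^ 2 + Z ^ 2 with hQ
  have hR0 : 0 < R := by linarith
  have q1 : |S * S| ≤ Q := by rw [abs_mul_self]; nlinarith [sq_nonneg X, sq_nonneg Z]
  have q2 : |Z * S| ≤ Q := by
    rw [abs_le]; constructor <;> nlinarith [sq_nonneg (Z + S), sq_nonneg (Z - S), sq_nonneg X, sq_nonneg Z, sq_nonneg S]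
  have q3 : |X * S| ≤ Q := by
    rw [abs_le]; constructor <;> nlinarith [sq_nonneg (X + S), sq_nonneg (X - S), sq_nonneg X, sq_nonneg Z, sq_nonneg S]
  have q4 : |Z * X| ≤ Q := by
    rw [abs_le]; constructor <;> nlinarith [sq_nonneg (X + Z), sq_nonneg (X - Z), sq_nonneg X, sq_nonneg Z, sq_nonneg S]
  have hQ0 : 0 ≤ Q := by positivity
  have hXQ : X ^ 2 ≤ Q := by nlinarith [sq_nonneg S, sq_nonneg Z]
  clear_value Q
  have pr : ∀ {x y z A B : ℝ}, |x| ≤ A → |y| ≤ B → |z| ≤ Q → |x * y * z| ≤ A * B * Q := by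
    intro x y z A B hx hy hz
    have : 0 ≤ A := (abs_nonneg x).trans hx
    have : 0 ≤ B := (abs_nonneg y).trans hy
    rw [abs_mul, abs_mul]; gcongr
  have t1 := (abs_le.mp (pr h3 h2 q1)).1
  have t2 := (abs_le.mp (pr h1 h4 q2)).2
  have t3 := (abs_le.mp (pr h3 h2 q3)).1
  have t4 := (abs_le.mp (pr h5 h2 q3)).1
  have t5 := (abs_le.mp (pr h3 h4 q4)).2
  have i1 : 0 ≤ 1 / R := by positivity
  have i2 : 1 / R ^ 2 ≤ 1 / R := by
    apply one_div_le_one_div_of_le hR0; nlinarith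
  have i3 : 0 ≤ 1 / R ^ 2 := by positivity
  have u1 : -(1 / R * (4 * D * Q)) ≤ 2 / R * (b1 * a2 * S - a1 * b2 * Z) * S := by
    have := mul_le_mul_of_nonneg_left (show -(4 * D * Q) ≤ 2 * (b1 * a2 * (S * S) - a1 * b2 * (Z * S)) by linarith) i1
    calc _ = 1 / R * -(4 * D * Q) := by ring
      _ ≤ _ := this
      _ = _ := by ring
  have u2 : -(1 / R * (2 * D * ε * Q)) ≤ 2 / R * (b1 * a2) * (ε * X * S) := by
    have := mul_le_mul_of_nonneg_left (show -(2 * D * ε * Q) ≤ 2 * ε * (b1 * a2 * (X * S)) by nlinarith) i1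
    calc _ = 1 / R * -(2 * D * ε * Q) := by ring
      _ ≤ _ := this
      _ = _ := by ring
  have u3 : -(1 / R * (2 * D * Q + 2 * D ^ 2 * Q)) ≤ 1 / 2 * (4 / R ^ 2 * (c1 * a2 * S - b1 * b2 * Z)) * X := by
    have := mul_le_mul_of_nonneg_left (show -(2 * D * Q + 2 * D ^ 2 * Q) ≤ 2 * (c1 * a2 * (X * S) - b1 * b2 * (Z * X)) by nlinarith) i3
    have h7 := mul_le_mul_of_nonneg_right i2 (show 0 ≤ 2 * D * Q + 2 * D ^ 2 * Q by positivity)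
    calc -(1 / R * (2 * D * Q + 2 * D ^ 2 * Q)) ≤ 1 / R ^ 2 * -(2 * D * Q + 2 * D ^ 2 * Q) := by linarith
      _ ≤ _ := this
      _ = _ := by ring
  have u4 : -(1 / R * (K * Q)) ≤ T3 := by
    refine le_trans ?_ hT
    have := mul_le_mul_of_nonneg_left hXQ (show 0 ≤ K / R by positivity)
    have e : 1 / R * (K * Q) = K / R * Q := by ring
    linarith
  have u5 : 0 ≤ η * (2 * ε * S ^ 2) := by positivity
  have e : (6 * D + 2 * D * ε + K + 2 * D ^ 2) / R * Q = 1 / R * (4 * D * Q) + 1 / R * (2 * D * ε * Q) + 1 / R * (2 * D * Q + 2 * D ^ 2 * Q) + 1 / R * (K * Q) := by ring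
  linarith

/-- exponent -/
def bb (n : ℕ) (ε : ℝ) : ℝ := (((n : ℝ) - 1) / 2 + ε) / 2

def cA {n : ℕ} (ε R : ℝ) (φ : Spacetime n → ℝ) : Spacetime n → ℝ :=
  curA (chi (bb n ε) φ) (eta R) (etas R)
def cB {n : ℕ} (ε σ p R : ℝ) (φ : Spacetime n → ℝ) : Spacetime n → ℝ :=
  curB (ε ^ 2 - ((n - 1) / 2) ^ 2) (σ / (p + 1)) (chi (bb n ε) φ) (eta R) (MM (bb n ε) p φ)

def divJ {n : ℕ} (ε σ p R : ℝ) (φ : Spacetime n → ℝ) (q : Spacetime n) : ℝ :=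
  dt (J0 (chi (bb n ε) φ) (cA ε R φ) (cB ε σ p R φ)) q
    + ∑ i, dx i (Ji (chi (bb n ε) φ) (cA ε R φ) (cB ε σ p R φ) i) q

lemma contDiffAt_NNpow {n : ℕ} {q : Spacetime n} (hq : q ∈ Dom n) (a : ℝ) :
    ContDiffAt ℝ 2 (fun q : Spacetime n => NN q ^ a) q :=
  contDiff_NN.contDiffAt.rpow_const_of_ne (NN_pos hq).ne'

lemma contDiffAt_chi {n : ℕ} {b : ℝ} {φ : Spacetime n → ℝ} {q : Spacetime n} (hq : q ∈ Dom n)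
    (h : ContDiffAt ℝ 2 φ q) : ContDiffAt ℝ 2 (chi b φ) q :=
  (contDiffAt_NNpow hq b).mul h

lemma contDiffAt_MM {n : ℕ} {b p : ℝ} (hp : 1 ≤ p) {φ : Spacetime n → ℝ} {q : Spacetime n} (hq : q ∈ Dom n)
    (h : ContDiffAt ℝ 2 φ q) : ContDiffAt ℝ 1 (MM b p φ) q := by
  have h1 : ContDiff ℝ 1 (fun x : ℝ => ‖x‖ ^ (p + 1)) := contDiff_norm_rpow (by linarith)
  exact ((contDiffAt_NNpow hq _).of_le (by norm_num)).mul (h1.contDiffAt.comp q (h.of_le (by norm_num)))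

lemma contDiffAt_SS {n : ℕ} {χ : Spacetime n → ℝ} {q : Spacetime n} (h : ContDiffAt ℝ 2 χ q) :
    ContDiffAt ℝ 1 (SS χ) q :=
  (h.fderiv_right (m := 1) (by norm_num)).clm_apply contDiffAt_id

lemma contDiffAt_PP {n : ℕ} {χ : Spacetime n → ℝ} {q : Spacetime n} (h : ContDiffAt ℝ 2 χ q) :
    ContDiffAt ℝ 1 (PP χ) q :=
  ((dt_diff h _).pow 2).neg.add (ContDiffAt.sum (fun _ _ => (dt_diff h _).pow 2))

lemma contDiffAt_cA {n : ℕ} {ε R : ℝ} {φ : Spacetime n → ℝ} {q : Spacetime n} (hq : q ∈ Dom n)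
    (h : ContDiffAt ℝ 2 φ q) : ContDiffAt ℝ 1 (cA ε R φ) q := by
  have h1 := contDiffAt_chi (b := bb n ε) hq h
  have l : (1 : WithTop ℕ∞) ≤ 2 := by norm_num
  exact ((contDiffAt_NNpow hq _).of_le l).mul ((contDiff_NN.contDiffAt.of_le l).mul
    ((((contDiffAt_eta hq).of_le l).mul (contDiffAt_SS h1)).add
      (contDiffAt_const.mul (((contDiffAt_etas hq).of_le l).mul (h1.of_le l)))))

lemma contDiffAt_cB {n : ℕ} {ε σ p R : ℝ} (hp : 1 ≤ p) {φ : Spacetime n → ℝ} {q : Spacetime n} (hq : q ∈ Dom n)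
    (h : ContDiffAt ℝ 2 φ q) : ContDiffAt ℝ 1 (cB ε σ p R φ) q := by
  have h1 := contDiffAt_chi (b := bb n ε) hq h
  have l : (1 : WithTop ℕ∞) ≤ 2 := by norm_num
  exact ((contDiffAt_NNpow hq _).of_le l).mul (((contDiffAt_eta hq).of_le l).mul
    (((contDiffAt_const.mul ((h1.of_le l).mul (h1.of_le l))).add (contDiffAt_const.mul (contDiffAt_MM hp hq h))).sub
      (contDiffAt_const.mul ((contDiff_NN.contDiffAt.of_le l).mul (contDiffAt_PP h1)))))

lemma divJ_lower {n : ℕ} (hn : 2 ≤ n) {δ ε σ p : ℝ} {φ : Spacetime n → ℝ} (hδ : 0 < δ) (hε : 0 < ε) (hp : 1 ≤ p)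
    (hφ : ContDiffOn ℝ 2 φ (Dom n)) (hdec : Dec δ φ)
    (heq : ∀ q ∈ Dom n, box φ q = - σ * (|φ q| ^ (p - 1) * φ q))
    (hσ : σ = 1 ∨ (σ = -1 ∧ 4 ≤ ((n : ℝ) - 1) * (p - 1))) :
    ∃ C : ℝ, 0 ≤ C ∧ ∀ R : ℝ, 1 ≤ R → ∀ q ∈ Dom n,
      Wt q * (eta R q * (σ * (2 - 2 * bb n ε * (p - 1)) / (p + 1) * MM (bb n ε) p φ q)) - C / R * gg ε δ q
        ≤ divJ ε σ p R φ q := by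
  obtain ⟨C, hC, hbd⟩ := dec_bounds hdec
  obtain ⟨K, hK, hM⟩ := M_bound (b := bb n ε) hδ hp hn hC (fun q hq => (hbd q hq).1) hσ
  obtain ⟨D, hD, hcb, hcc⟩ := c_bdd
  set E := (6 * D + 2 * D * ε + K + 2 * D ^ 2) with hE
  have hE0 : 0 ≤ E := by positivity
  refine ⟨E * (C ^ 2 * (4 + 8 * bb n ε ^ 2)), by positivity, fun R hR q hq => ?_⟩
  have hR0 : 0 < R := by linarith
  have hN := NN_pos hq
  have hc : ContDiffAt ℝ 2 φ q := hφ.contDiffAt (isOpen_Dom.mem_nhds hq)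
  have hd := hc.differentiableAt (by norm_num)
  have hχ := contDiffAt_chi (b := bb n ε) hq hc
  obtain ⟨m1, m2, m3⟩ := MM_props (b := bb n ε) hp hN hd
  have hdiv : divJ ε σ p R φ q = _ := (div_J hχ ((contDiffAt_cA hq hc).differentiableAt (by norm_num))
    ((contDiffAt_cB hp hq hc).differentiableAt (by norm_num))).trans
    (key_identity (ε := ε) (σ := σ) hN hχ ((contDiffAt_eta hq).differentiableAt (by norm_num))
      ((contDiffAt_etas hq).differentiableAt (by norm_num)) m1 hp (fderiv_eta_self hq) m2 m3
      (pde_chi hq hφ (heq q hq)))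
  rw [hdiv, fderiv_eta_Y hq, fderiv_etas_Y hq]
  have hWt : 0 ≤ Wt q := by unfold Wt; positivity
  have hη : 0 ≤ eta R q := by
    unfold eta; rw [Set.indicator_of_mem hq]; exact mul_nonneg (ca_nonneg _) (ca_nonneg _)
  have ab : ∀ x, |ca x| ≤ 1 := fun x => by rw [abs_of_nonneg (ca_nonneg x)]; exact ca_le_one x
  have hes : etas R q = 2 / R * (cb (ell q / R) * ca (th q / R)) := by
    unfold etas; rw [Set.indicator_of_mem hq]
  have := alg_bound (S := SS (chi (bb n ε) φ) q) (Z := ZZ (chi (bb n ε) φ) q)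
    (κM := σ * (2 - 2 * bb n ε * (p - 1)) / (p + 1) * MM (bb n ε) p φ q) hR hε hD hη (ab (ell q / R)) (ab (th q / R))
    (hcb (ell q / R)) (hcb (th q / R)) (hcc (ell q / R)) hK (hM R hR q hq)
  rw [← hes] at this
  refine le_trans ?_ (mul_le_mul_of_nonneg_left this hWt)
  have hw := mul_le_mul_of_nonneg_left (weight_bound hq hd (b := bb n ε) rfl (hbd q hq)) (show 0 ≤ E / R by positivity)
  have e1 : E * (C ^ 2 * (4 + 8 * bb n ε ^ 2)) / R * gg ε δ q = E / R * (C ^ 2 * (4 + 8 * bb n ε ^ 2) * gg ε δ q) := by ring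
  rw [e1, mul_sub]
  linarith

def KK (n : ℕ) (R : ℝ) : Set (Spacetime n) :=
  {q | Real.exp (-R) ≤ ‖q.2‖ + q.1 ∧ ‖q.2‖ + q.1 ≤ Real.exp R ∧
    Real.exp (-R) ≤ ‖q.2‖ - q.1 ∧ ‖q.2‖ - q.1 ≤ Real.exp R}

lemma KK_sub {n : ℕ} {R : ℝ} : KK n R ⊆ Dom n := by
  rintro q ⟨h1, -, h3, -⟩
  have := Real.exp_pos (-R)
  change |q.1| < ‖q.2‖
  rw [abs_lt]; constructor <;> linarith

lemma KK_compact {n : ℕ} {R : ℝ} : IsCompact (KK n R) := by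
  have hc : IsClosed (KK n R) := by
    have e : KK n R = {q | Real.exp (-R) ≤ ‖q.2‖ + q.1} ∩ ({q | ‖q.2‖ + q.1 ≤ Real.exp R} ∩
      ({q | Real.exp (-R) ≤ ‖q.2‖ - q.1} ∩ {q | ‖q.2‖ - q.1 ≤ Real.exp R})) := rfl
    rw [e]
    refine (isClosed_le ?_ ?_).inter ((isClosed_le ?_ ?_).inter ((isClosed_le ?_ ?_).inter (isClosed_le ?_ ?_)))
    all_goals fun_prop
  refine Metric.isCompact_of_isClosed_isBounded hc ?_
  refine Metric.isBounded_closedBall.subset (s := KK n R) (t := Metric.closedBall 0 (Real.exp R)) ?_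
  rintro q ⟨h1, h2, h3, h4⟩
  have := Real.exp_pos (-R)
  rw [mem_closedBall_zero_iff, Prod.norm_def]
  apply max_le
  · rw [Real.norm_eq_abs, abs_le]; constructor <;> linarith [norm_nonneg q.2]
  · linarith

lemma eta_off {n : ℕ} {R : ℝ} (hR : 0 < R) {q : Spacetime n} (hq : q ∉ KK n R) :
    eta R q = 0 ∧ etas R q = 0 := by
  by_cases hD : q ∈ Dom n
  · unfold eta etas
    rw [Set.indicator_of_mem hD, Set.indicator_of_mem hD]
    by_cases h1 : 1 ≤ |ell q / R|
    · rw [ca_zero h1, cb_zero h1]; simp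
    by_cases h2 : 1 ≤ |th q / R|
    · rw [ca_zero h2]; simp
    exfalso
    apply hq
    push Not at h1 h2
    rw [abs_div, abs_of_pos hR, div_lt_one hR, abs_lt] at h1 h2
    obtain ⟨p1, p2, p3⟩ := Dom_pos hD
    have el : ell q = Real.log (‖q.2‖ + q.1) + Real.log (‖q.2‖ - q.1) := by
      unfold ell
      rw [← Real.log_mul p1.ne' p2.ne']; congr 1; unfold NN; ring
    have et : th q = Real.log (‖q.2‖ + q.1) - Real.log (‖q.2‖ - q.1) := rfl
    refine ⟨?_, ?_, ?_, ?_⟩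
    · rw [← Real.le_log_iff_exp_le p1]; linarith
    · rw [← Real.log_le_iff_le_exp p1]; linarith
    · rw [← Real.le_log_iff_exp_le p2]; linarith
    · rw [← Real.log_le_iff_le_exp p2]; linarith
  · unfold eta etas
    rw [Set.indicator_of_notMem hD, Set.indicator_of_notMem hD]; simp

lemma int_fderiv_zero {n : ℕ} {f : Spacetime n → ℝ} {K : Set (Spacetime n)} (hK : IsCompact K) (hKD : K ⊆ Dom n)
    (h0 : ∀ q ∉ K, f q = 0) (hf : ∀ q ∈ Dom n, ContDiffAt ℝ 1 f q) (v : Spacetime n) :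
    Integrable (fun q => fderiv ℝ f q v) ∧ ∫ q, fderiv ℝ f q v = 0 ∧ ∀ q ∉ K, fderiv ℝ f q v = 0 := by
  have hev : ∀ q ∉ K, f =ᶠ[nhds q] (fun _ => 0) := by
    intro q hq
    filter_upwards [hK.isClosed.isOpen_compl.mem_nhds hq] with y hy using h0 y hy
  have hc : ContDiff ℝ 1 f := by
    rw [contDiff_iff_contDiffAt]
    intro q
    by_cases hq : q ∈ K
    · exact hf q (hKD hq)
    · exact contDiffAt_const.congr_of_eventuallyEq (hev q hq)
  have hs : HasCompactSupport f := HasCompactSupport.intro hK h0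
  have hi : Integrable (fun q => fderiv ℝ f q v) := by
    refine Continuous.integrable_of_hasCompactSupport ?_ (hs.fderiv_apply ℝ v)
    exact (hc.continuous_fderiv (by norm_num)).clm_apply continuous_const
  refine ⟨hi, ?_, fun q hq => ?_⟩
  · have hfi : Integrable f := hc.continuous.integrable_of_hasCompactSupport hs
    haveI : (volume : Measure (Spacetime n)).IsAddHaarMeasure :=
      inferInstanceAs ((volume : Measure ℝ).prod (volume : Measure (EuclideanSpace ℝ (Fin n)))).IsAddHaarMeasure
    have := integral_mul_fderiv_eq_neg_fderiv_mul_of_integrable (μ := (volume : Measure (Spacetime n)))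
      (f := fun _ => (1:ℝ)) (g := f) (v := v) (by simp) (by simpa using hi) (by simpa using hfi)
      (fun x _ => by fun_prop) (fun x _ => (hc.differentiable (by norm_num)) x)
    simpa using this
  · rw [(hev q hq).fderiv_eq]; simp

lemma divJ_int {n : ℕ} {ε σ p R : ℝ} (hR : 0 < R) (hp : 1 ≤ p) {φ : Spacetime n → ℝ}
    (hφ : ContDiffOn ℝ 2 φ (Dom n)) :
    Integrable (divJ ε σ p R φ) ∧ ∫ q, divJ ε σ p R φ q = 0 ∧ ∀ q ∉ Dom n, divJ ε σ p R φ q = 0 := by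
  have hA0 : ∀ q ∉ KK n R, cA ε R φ q = 0 := by
    intro q hq; unfold cA curA; rw [(eta_off hR hq).1, (eta_off hR hq).2]; simp
  have hB0 : ∀ q ∉ KK n R, cB ε σ p R φ q = 0 := by
    intro q hq; unfold cB curB; rw [(eta_off hR hq).1]; simp
  have hc : ∀ q ∈ Dom n, ContDiffAt ℝ 2 φ q := fun q hq => hφ.contDiffAt (isOpen_Dom.mem_nhds hq)
  have e0 := int_fderiv_zero (f := J0 (chi (bb n ε) φ) (cA ε R φ) (cB ε σ p R φ)) (KK_compact (R := R)) KK_sub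
    (fun q hq => by unfold J0; rw [hA0 q hq, hB0 q hq]; simp)
    (fun q hq => ((dt_diff (contDiffAt_chi hq (hc q hq)) _).neg.mul (contDiffAt_cA hq (hc q hq))).add
      (contDiffAt_fst.mul (contDiffAt_cB hp hq (hc q hq)))) (1, 0)
  have ei := fun i => int_fderiv_zero (f := Ji (chi (bb n ε) φ) (cA ε R φ) (cB ε σ p R φ) i) (KK_compact (R := R)) KK_sub
    (fun q hq => by unfold Ji; rw [hA0 q hq, hB0 q hq]; simp)
    (fun q hq => ((dt_diff (contDiffAt_chi hq (hc q hq)) _).mul (contDiffAt_cA hq (hc q hq))).add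
      (ContDiffAt.mul (((EuclideanSpace.proj i).comp (ContinuousLinearMap.snd ℝ ℝ (EuclideanSpace ℝ (Fin n)))).contDiff.contDiffAt)
        (contDiffAt_cB hp hq (hc q hq)))) (0, EuclideanSpace.single i 1)
  have his : Integrable (fun q => ∑ i, dx i (Ji (chi (bb n ε) φ) (cA ε R φ) (cB ε σ p R φ) i) q) :=
    integrable_finsetSum _ (fun i _ => (ei i).1)
  refine ⟨e0.1.add his, ?_, fun q hq => ?_⟩
  · unfold divJ
    have h1 : ∫ q, dt (J0 (chi (bb n ε) φ) (cA ε R φ) (cB ε σ p R φ)) q = 0 := e0.2.1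
    have h2 : ∀ i, ∫ q, dx i (Ji (chi (bb n ε) φ) (cA ε R φ) (cB ε σ p R φ) i) q = 0 := fun i => (ei i).2.1
    refine (integral_add e0.1 his).trans ?_
    have h3 : ∫ q, ∑ i, dx i (Ji (chi (bb n ε) φ) (cA ε R φ) (cB ε σ p R φ) i) q = ∑ i, ∫ q, dx i (Ji (chi (bb n ε) φ) (cA ε R φ) (cB ε σ p R φ) i) q :=
      integral_finsetSum _ (fun i _ => (ei i).1)
    rw [h3, Finset.sum_eq_zero (fun i _ => h2 i), add_zero]
    exact h1
  · unfold divJ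
    have hk : q ∉ KK n R := fun h => hq (KK_sub h)
    have h1 : dt (J0 (chi (bb n ε) φ) (cA ε R φ) (cB ε σ p R φ)) q = 0 := e0.2.2 q hk
    have h2 : ∀ i, dx i (Ji (chi (bb n ε) φ) (cA ε R φ) (cB ε σ p R φ) i) q = 0 := fun i => (ei i).2.2 q hk
    rw [h1]; simp [h2]

lemma main_vanish {n : ℕ} (hn : 2 ≤ n) {δ ε σ p : ℝ} {φ : Spacetime n → ℝ} (hε : 0 < ε) (hεδ : ε < δ) (hp : 1 ≤ p)
    (hφ : ContDiffOn ℝ 2 φ (Dom n)) (hdec : Dec δ φ)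
    (heq : ∀ q ∈ Dom n, box φ q = - σ * (|φ q| ^ (p - 1) * φ q))
    (hσ : σ = 1 ∨ (σ = -1 ∧ 4 ≤ ((n : ℝ) - 1) * (p - 1)))
    (hk : 0 < σ * (2 - 2 * bb n ε * (p - 1))) :
    ∀ q ∈ Dom n, φ q = 0 := by
  obtain ⟨C, hC, hlow⟩ := divJ_lower hn (hε.trans hεδ) hε hp hφ hdec heq hσ
  intro q0 hq0
  by_contra hne
  set κ := σ * (2 - 2 * bb n ε * (p - 1)) / (p + 1) with hκ
  have hκ0 : 0 < κ := by rw [hκ]; exact div_pos hk (by linarith)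
  set G : Spacetime n → ℝ := fun q => Wt q * (κ * MM (bb n ε) p φ q) with hG
  have hc0 : ContDiffAt ℝ 2 φ q0 := hφ.contDiffAt (isOpen_Dom.mem_nhds hq0)
  have hGc : ContinuousAt G q0 :=
    (contDiffAt_NNpow hq0 _).continuousAt.mul (continuousAt_const.mul (contDiffAt_MM hp hq0 hc0).continuousAt)
  have hN0 := NN_pos hq0
  have hG0 : 0 < G q0 := by
    have : 0 < |φ q0| := abs_pos.mpr hne
    simp only [hG, Wt, MM]; positivity
  set L : ℝ := max (|ell q0| + 1) (|th q0| + 1) with hL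
  have hev : ∀ᶠ q in nhds q0, q ∈ Dom n ∧ G q0 / 2 < G q ∧ |ell q| < |ell q0| + 1 ∧ |th q| < |th q0| + 1 := by
    refine (isOpen_Dom.eventually_mem hq0).and ((hGc.eventually_const_lt (by linarith)).and
      (((contDiffAt_ell hq0).continuousAt.abs.eventually_lt_const (by linarith)).and
        ((contDiffAt_th hq0).continuousAt.abs.eventually_lt_const (by linarith))))
  obtain ⟨r, hr, hball⟩ := Metric.nhds_basis_closedBall.eventually_iff.mp hev
  set B := Metric.closedBall q0 r with hB
  set m := Real.smoothTransition (3 / 4) with hm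
  have hm0 : 0 < m := Real.smoothTransition.pos_of_pos (by norm_num)
  have hgi := gg_integrable hn hε hεδ (n := n)
  have hBfin : volume B ≠ ⊤ := (isCompact_closedBall q0 r).measure_lt_top.ne
  have hBpos : 0 < volume.real B :=
    ENNReal.toReal_pos (Metric.measure_closedBall_pos volume q0 hr).ne' hBfin
  have main : ∀ R : ℝ, max 1 (2 * L) ≤ R → R * (G q0 / 2 * (m * m) * volume.real B) ≤ C * ∫ q, gg (n := n) ε δ q := by
    intro R hR
    have hR1 : 1 ≤ R := (le_max_left _ _).trans hR
    have hR2 : 2 * L ≤ R := (le_max_right _ _).trans hR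
    have hR0 : 0 < R := by linarith
    obtain ⟨i1, i2, i3⟩ := divJ_int (ε := ε) (σ := σ) hR0 hp hφ
    have hpt : ∀ q, B.indicator (fun _ => G q0 / 2 * (m * m)) q ≤ divJ ε σ p R φ q + C / R * gg ε δ q := by
      intro q
      by_cases hq : q ∈ Dom n
      · have h1 := hlow R hR1 q hq
        have hη : eta R q = ca (ell q / R) * ca (th q / R) := by
          unfold eta; rw [Set.indicator_of_mem hq]
        have hN := NN_pos hq
        have h2 : Wt q * (eta R q * (κ * MM (bb n ε) p φ q)) = eta R q * G q := by simp only [hG]; ring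
        rw [h2] at h1
        have hGn : 0 ≤ G q := by simp only [hG, Wt, MM]; positivity
        refine le_trans ?_ (by linarith : eta R q * G q ≤ _)
        by_cases hqB : q ∈ B
        · rw [Set.indicator_of_mem hqB]
          obtain ⟨-, g1, g2, g3⟩ := hball hqB
          have small : ∀ y : ℝ, |y| ≤ L → |y / R| ≤ 1 / 2 := by
            intro y hy
            rw [abs_div, abs_of_pos hR0, div_le_iff₀ hR0]; linarith
          have a1 := ca_lower (small (ell q) (g2.le.trans (le_max_left _ _)))
          have a2 := ca_lower (small (th q) (g3.le.trans (le_max_right _ _)))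
          rw [hη, mul_comm]
          have n1 := ca_nonneg (ell q / R)
          have n2 := ca_nonneg (th q / R)
          have n3 : m * m ≤ ca (ell q / R) * ca (th q / R) := mul_le_mul a1 a2 hm0.le n1
          exact mul_le_mul n3 g1.le (by positivity) (mul_nonneg n1 n2)
        · rw [Set.indicator_of_notMem hqB, hη]
          exact mul_nonneg (mul_nonneg (ca_nonneg _) (ca_nonneg _)) hGn
      · have hqB : q ∉ B := fun h => hq (hball h).1
        have hg0 : gg ε δ q = 0 := by unfold gg; rw [Set.indicator_of_notMem hq]
        rw [Set.indicator_of_notMem hqB, i3 q hq, hg0]; simp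
    have hmeas : MeasurableSet B := Metric.isClosed_closedBall.measurableSet
    have hint := integral_mono (μ := volume)
      ((integrable_indicator_iff hmeas).mpr (integrableOn_const hBfin)) (i1.add (hgi.const_mul (C / R))) hpt
    rw [integral_add' i1 (hgi.const_mul (C / R)), i2, integral_const_mul, integral_indicator_const _ hmeas, smul_eq_mul, zero_add] at hint
    have h9 := mul_le_mul_of_nonneg_left hint hR0.le
    calc R * (G q0 / 2 * (m * m) * volume.real B) = R * (volume.real B * (G q0 / 2 * (m * m))) := by ring
      _ ≤ _ := h9
      _ = _ := by field_simp
  set c := G q0 / 2 * (m * m) * volume.real B with hc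
  have hcpos : 0 < c := by positivity
  set I := C * ∫ q, gg (n := n) ε δ q with hI
  have h := main (max (max 1 (2 * L)) ((|I| + 1) / c)) (le_max_left _ _)
  have h2 := mul_le_mul_of_nonneg_right (le_max_right (max 1 (2 * L)) ((|I| + 1) / c)) hcpos.le
  rw [div_mul_cancel₀ _ hcpos.ne'] at h2
  linarith [le_abs_self I]

/-- **Corollary 1.12** (unique continuation for the constant-coefficient power nonlinearities):
if `φ ∈ C²(D)` solves either the focusing equation `□φ + |φ|^{p−1}φ = 0` with
`1 ≤ p < 1 + 4/(n−1)`, or the defocusing equation `□φ − |φ|^{p−1}φ = 0` with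
`p ≥ 1 + 4/(n−1)`, and satisfies the decay condition `Dec(δ)`, then `φ ≡ 0` on `D`. -/
theorem uc_corollary (n : ℕ) (hn : 2 ≤ n) (δ : ℝ) (hδ : 0 < δ)
    (φ : Spacetime n → ℝ)
    (hφ : ContDiffOn ℝ 2 φ (Dom n))
    (heq :
      (∃ p : ℝ, 1 ≤ p ∧ p < 1 + 4 / ((n : ℝ) - 1) ∧
        ∀ q ∈ Dom n, box φ q + |φ q| ^ (p - 1) * φ q = 0) ∨
      (∃ p : ℝ, 1 + 4 / ((n : ℝ) - 1) ≤ p ∧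
        ∀ q ∈ Dom n, box φ q - |φ q| ^ (p - 1) * φ q = 0))
    (hdec : Dec δ φ) :
    ∀ q ∈ Dom n, φ q = 0 := by
  have hn' : (2:ℝ) ≤ n := by exact_mod_cast hn
  have hn1 : 0 < (n:ℝ) - 1 := by linarith
  rcases heq with ⟨p, hp1, hp2, heq⟩ | ⟨p, hp1, heq⟩
  · have hs : ((n:ℝ) - 1) * (p - 1) < 4 := by
      have : p - 1 < 4 / ((n:ℝ) - 1) := by linarith
      rwa [lt_div_iff₀' hn1] at this
    obtain ⟨ε, hε, hεδ, hεs⟩ : ∃ ε : ℝ, 0 < ε ∧ ε < δ ∧ ε * (p - 1) < 2 - ((n:ℝ) - 1) / 2 * (p - 1) := by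
      set s := 2 - ((n:ℝ) - 1) / 2 * (p - 1) with hsdef
      have hs0 : 0 < s := by rw [hsdef]; linarith
      refine ⟨min (δ / 2) (s / (2 * p)), by positivity, (min_le_left _ _).trans_lt (by linarith), ?_⟩
      have h1 : min (δ / 2) (s / (2 * p)) * (p - 1) ≤ s / (2 * p) * (p - 1) :=
        mul_le_mul_of_nonneg_right (min_le_right _ _) (by linarith)
      have h2 : s / (2 * p) * (p - 1) ≤ s / (2 * p) * p :=
        mul_le_mul_of_nonneg_left (by linarith) (by positivity)
      have h3 : s / (2 * p) * p = s / 2 := by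
        have : p ≠ 0 := by linarith
        field_simp
      linarith
    refine main_vanish (σ := 1) hn hε hεδ hp1 hφ hdec (fun q hq => ?_) (Or.inl rfl) ?_
    · linarith [heq q hq]
    · unfold bb
      linarith
  · have hs : 4 ≤ ((n:ℝ) - 1) * (p - 1) := by
      have : 4 / ((n:ℝ) - 1) ≤ p - 1 := by linarith
      rwa [div_le_iff₀' hn1] at this
    have hp : 1 < p := by
      have : 0 < 4 / ((n:ℝ) - 1) := by positivity
      linarith
    refine main_vanish (σ := -1) (ε := δ / 2) hn (by linarith) (by linarith) hp.le hφ hdec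
      (fun q hq => ?_) (Or.inr ⟨rfl, hs⟩) ?_
    · linarith [heq q hq]
    · unfold bb
      have : 0 < δ / 2 * (p - 1) := mul_pos (by linarith) (by linarith)
      linarith
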